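/- arXiv:1406.0241 — 2 statements merged into one kernel-verified Lean document; each statement's English description precedes it below -/
import Mathlib

section
/- Let S = Spec(R) be a regular semi-local scheme such that the residue field at every closed point of S is finite. Let T be a closed subscheme of S. Let X̄ be a closed subscheme of the projective space P^d_S = Proj(R[X_0, ..., X_d]) and X = X̄ ∩ A^d_S, where A^d_S is the affine open defined by X_0 ≠ 0; let X_∞ = X̄ \ X be the intersection of X̄ with the hyperplane at infinity X_0 = 0. Assume that over T there exists a section δ : T → X of the canonical projection X → S, and assume further: (1) X is smooth and equidimensional over S of relative dimension r; (2) for every closed point s ∈ S the closed fibres satisfy dim(X_∞(s)) < dim(X(s)) = r. Then there exists a closed subscheme S̃ of X which is finite étale over S and contains δ(T). -/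
/-!
STATEMENT 4 (Lemma 5.2 / Lemma 7.2 of Ojanguren–Panin, over finite residue fields).

Let `S = Spec R` be a regular semi-local scheme all of whose closed points have finite
residue fields, `T = Spec (R ⧸ I)` a closed subscheme of `S`, `X̄` a closed subscheme of
`ℙ^d_S` and `X = X̄ ∩ 𝔸^d_S` (the locus `X₀ ≠ 0`), `X_∞ = X̄ ∖ X`.  Assume there is a
section `δ : T → X` of the projection `X → S` over `T`, that `X` is smooth and
equidimensional over `S` of relative dimension `r`, and that for every closed point
`s ∈ S` one has `dim X_∞(s) < dim X(s) = r`.  Then there is a closed subscheme `S̃` of `X`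
which is finite étale over `S` and contains `δ(T)`.
-/

open AlgebraicGeometry CategoryTheory CategoryTheory.Limits TopologicalSpace

universe u

noncomputable section

namespace GS

/-- A Noetherian local ring is regular if its maximal ideal is generated by
`dim R` elements. -/
def IsRegularLocalRing (R : Type*) [CommRing R] : Prop :=
  IsNoetherianRing R ∧
    ∃ h : IsLocalRing R, ∃ s : Finset R,
      Ideal.span (s : Set R) = @IsLocalRing.maximalIdeal R _ h ∧
      (s.card : WithBot ℕ∞) = ringKrullDim R

attribute [local instance] MvPolynomial.gradedAlgebra

/-- Projective `d`-space over `R`, `ℙ^d_R = Proj R[X₀, …, X_d]`. -/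
def ProjSpace (R : Type u) [CommRing R] (d : ℕ) : Scheme.{u} :=
  Proj (MvPolynomial.homogeneousSubmodule (Fin (d + 1)) R)

/-- The structure morphism `ℙ^d_R ⟶ Spec R`. -/
def ProjSpace.toSpec (R : Type u) [CommRing R] (d : ℕ) :
    ProjSpace R d ⟶ Spec (CommRingCat.of R) :=
  Proj.toSpecZero _ ≫ Spec.map (CommRingCat.ofHom
    (algebraMap R ↥(MvPolynomial.homogeneousSubmodule (Fin (d + 1)) R 0)))

/-- A subset `Z` of a topological space has dimension less than `n` if every chain of irreducible
closed subsets contained in `Z` has length less than `n`. -/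
def DimLT {X : Type*} [TopologicalSpace X] (Z : Set X) (n : ℕ) : Prop :=
  ∀ L : LTSeries (IrreducibleCloseds X), (L.last : Set X) ⊆ Z → L.length < n

section Dimension

variable {X : Type*} [TopologicalSpace X]

lemma DimLT.mono {Z Z' : Set X} {n m : ℕ} (h : DimLT Z n) (hZ : Z' ⊆ Z) (hnm : n ≤ m) :
    DimLT Z' m :=
  fun L hL ↦ (h L (hL.trans hZ)).trans_le hnm

lemma DimLT.eq_empty {Z : Set X} (h : DimLT Z 0) (hZ : IsClosed Z) : Z = ∅ := by
  by_contra hne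
  obtain ⟨z, hz⟩ := Set.nonempty_iff_ne_empty.mpr hne
  let V : IrreducibleCloseds X := ⟨closure {z}, isIrreducible_singleton.closure, isClosed_closure⟩
  exact absurd (h (RelSeries.singleton _ V)
    (closure_minimal (Set.singleton_subset_iff.mpr hz) hZ)) (by simp)

lemma DimLT.iUnion {ι : Type*} [Finite ι] {Z : ι → Set X} {n : ℕ} (hZ : ∀ i, IsClosed (Z i))
    (h : ∀ i, DimLT (Z i) n) : DimLT (⋃ i, Z i) n := by
  intro L hL
  obtain ⟨t, ht, hi⟩ := isIrreducible_iff_sUnion_isClosed.mp L.last.isIrreducible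
    (Set.finite_range Z).toFinset (by simpa using hZ) (by simpa using hL)
  obtain ⟨i, rfl⟩ : t ∈ Set.range Z := by simpa using ht
  exact h i L hi

lemma dimLT_of_topologicalKrullDim_lt {Z : Set X} {n : ℕ} (h : topologicalKrullDim Z < n) :
    DimLT Z n := by
  intro L hL
  have hsub (i) : (L i : Set X) ⊆ Z :=
    (show (L i : Set X) ⊆ L.last from L.monotone (Fin.le_last i)).trans hL
  let M : LTSeries (IrreducibleCloseds Z) :=
    { length := L.length
      toFun i :=
        { carrier := Subtype.val ⁻¹' (L i : Set X)
          isIrreducible' := by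
            obtain ⟨⟨x, hx⟩, hpre⟩ := (L i).isIrreducible
            refine ⟨⟨⟨x, hsub i hx⟩, hx⟩, ?_⟩
            rintro _ _ ⟨u, hu, rfl⟩ ⟨v, hv, rfl⟩ ⟨a, ha, hau⟩ ⟨b, hb, hbv⟩
            obtain ⟨y, hy, hyuv⟩ := hpre u v hu hv ⟨a, ha, hau⟩ ⟨b, hb, hbv⟩
            exact ⟨⟨y, hsub i hy⟩, hy, hyuv⟩
          isClosed' := (L i).isClosed.preimage continuous_subtype_val }
      step i := by
        have hlt : L i.castSucc < L i.succ := L.step i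
        have hle : (L i.castSucc : Set X) ⊆ L i.succ := hlt.le
        refine ⟨fun x hx ↦ @hle x.1 hx, fun hge ↦ hlt.not_ge fun x hx ↦ ?_⟩
        exact hge (show (⟨x, hsub _ hx⟩ : Z) ∈ Subtype.val ⁻¹' (L i.succ : Set X) from hx) }
  have := (Order.LTSeries.length_le_krullDim M).trans_lt h
  exact_mod_cast this

lemma exists_finset_generic [NoetherianSpace X] [QuasiSober X] [T0Space X] {Z : Set X}
    (hZ : IsClosed Z) : ∃ G : Finset X, (∀ g ∈ G, g ∈ Z) ∧ (∀ z ∈ Z, ∃ g ∈ G, g ⤳ z) ∧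
      ∀ g ∈ G, ∀ g' ∈ G, g ⤳ g' → g = g' := by
  classical
  obtain ⟨S, hS, hcl, hirr, rfl⟩ := NoetherianSpace.exists_finite_set_isClosed_irreducible hZ
  let M : Set (Set X) := {t | Maximal (· ∈ S) t}
  have hMS : M ⊆ S := fun t ht ↦ ht.prop
  have hM : M.Finite := hS.subset hMS
  have hgen (t) (ht : t ∈ S) : ∃ g, IsGenericPoint g t := QuasiSober.sober (hirr t ht) (hcl t ht)
  obtain hX | hX := isEmpty_or_nonempty X
  · exact ⟨∅, by simp, fun z ↦ isEmptyElim z, by simp⟩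
  choose! γ hγ using hgen
  refine ⟨hM.toFinset.image γ, ?_, ?_, ?_⟩
  · simp only [Finset.mem_image, Set.Finite.mem_toFinset]
    rintro _ ⟨t, ht, rfl⟩
    exact ⟨t, hMS ht, (hγ t (hMS ht)).mem⟩
  · rintro z ⟨t, ht, hz⟩
    obtain ⟨m, htm, hm⟩ := hS.exists_le_maximal ht
    exact ⟨γ m, Finset.mem_image_of_mem _ (hM.mem_toFinset.mpr hm),
      (hγ m (hMS hm)).specializes (htm hz)⟩
  · simp only [Finset.mem_image, Set.Finite.mem_toFinset]
    rintro _ ⟨t, ht, rfl⟩ _ ⟨t', ht', rfl⟩ h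
    have : t' ⊆ t := by
      rw [← hγ t (hMS ht), ← hγ t' (hMS ht')]
      exact h.closure_subset
    rw [ht'.eq_of_subset (hMS ht) this]

lemma DimLT.of_disjoint_generic [QuasiSober X] {Z Z' : Set X} {n : ℕ} (h : DimLT Z (n + 1))
    (hZ : IsClosed Z) (hsub : Z' ⊆ Z) {G : Set X} (hGZ : G ⊆ Z)
    (hG : ∀ z ∈ Z, ∃ g ∈ G, g ⤳ z) (hGZ' : Disjoint G Z') : DimLT Z' n := by
  intro L hL
  obtain ⟨v, hv⟩ := QuasiSober.sober L.last.isIrreducible L.last.isClosed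
  obtain ⟨g, hgG, hgv⟩ := hG v (hsub (hL hv.mem))
  let V : IrreducibleCloseds X := ⟨closure {g}, isIrreducible_singleton.closure, isClosed_closure⟩
  have hlt : L.last < V := by
    refine lt_of_le_of_ne ?_ ?_
    · show (L.last : Set X) ⊆ closure {g}
      rw [← hv.def]
      exact hgv.closure_subset
    · intro heq
      have : g ∈ (L.last : Set X) := by
        rw [heq]; exact subset_closure rfl
      exact Set.disjoint_left.mp hGZ' hgG (hL this)
  have := h (L.snoc V hlt) (by
    rw [RelSeries.last_snoc]
    exact closure_minimal (Set.singleton_subset_iff.mpr (hGZ hgG)) hZ)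
  simpa using this

end Dimension

section PrimeAvoidance

variable {A : Type*} [CommRing A]

open Classical in
/-- Finitely many elements of `K` suffice to move any `x` off finitely many pairwise incomparable
primes not containing `K` by adding an `e`-th power. -/
lemma exists_finset_add_pow_notMem (K : Ideal A) (G : Finset (PrimeSpectrum A))
    (hK : ∀ g ∈ G, ¬ K ≤ g.asIdeal)
    (hG : ∀ g ∈ G, ∀ g' ∈ G, g.asIdeal ≤ g'.asIdeal → g = g') {e : ℕ} (he : e ≠ 0) :
    ∃ C : Finset A, (∀ c ∈ C, c ∈ K) ∧ ∀ x, ∃ c ∈ C, ∀ g ∈ G, x + c ^ e ∉ g.asIdeal := by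
  have key : ∀ g : PrimeSpectrum A, ∃ y ∈ K, g ∈ G →
      (y ∉ g.asIdeal ∧ ∀ k ∈ G, k ≠ g → y ∈ k.asIdeal) := by
    intro g
    by_cases hg : g ∈ G
    swap
    · exact ⟨0, K.zero_mem, fun h ↦ absurd h hg⟩
    have h : ¬ K * ∏ k ∈ G.erase g, k.asIdeal ≤ g.asIdeal := by
      rw [g.isPrime.mul_le, g.isPrime.prod_le]
      rintro (h | ⟨k, hk, hkg⟩)
      · exact hK g hg h
      · exact Finset.ne_of_mem_erase hk (hG k (Finset.mem_of_mem_erase hk) g hg hkg)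
    obtain ⟨y, hy, hyg⟩ := SetLike.not_le_iff_exists.mp h
    have hyK : y ∈ K := Ideal.mul_le_left hy
    have hy' : y ∈ ∏ k ∈ G.erase g, k.asIdeal :=
      Ideal.mul_le_right hy
    refine ⟨y, hyK, fun _ ↦ ⟨hyg, fun k hk hkg ↦ ?_⟩⟩
    exact Ideal.le_of_dvd (Finset.dvd_prod_of_mem PrimeSpectrum.asIdeal
      (Finset.mem_erase.mpr ⟨hkg, hk⟩)) hy'
  choose y hyK hy using key
  refine ⟨G.powerset.image fun S ↦ ∑ g ∈ S, y g, ?_, fun x ↦ ?_⟩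
  · simp only [Finset.mem_image, forall_exists_index, and_imp, forall_apply_eq_imp_iff₂]
    exact fun S _ ↦ sum_mem fun g _ ↦ hyK g
  refine ⟨∑ g ∈ G with x ∈ g.asIdeal, y g,
    Finset.mem_image_of_mem _ (Finset.mem_powerset.mpr (Finset.filter_subset _ _)),
    fun g hg hmem ↦ ?_⟩
  by_cases hx : x ∈ g.asIdeal
  · have h1 := g.isPrime.mem_of_pow_mem _ ((Ideal.add_mem_iff_right _ hx).mp hmem)
    rw [← Finset.add_sum_erase _ _ (Finset.mem_filter.mpr ⟨hg, hx⟩)] at h1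
    refine (hy g hg).1 ((Ideal.add_mem_iff_left _ (sum_mem fun k hk ↦ ?_)).mp h1)
    obtain ⟨hkg, hk⟩ := Finset.mem_erase.mp hk
    exact (hy k (Finset.mem_filter.mp hk).1).2 g hg hkg.symm
  · refine hx ((Ideal.add_mem_iff_left _ (Ideal.pow_mem_of_mem _ (sum_mem fun k hk ↦ ?_) _
      (Nat.pos_of_ne_zero he))).mp hmem)
    obtain ⟨hk, hxk⟩ := Finset.mem_filter.mp hk
    exact (hy k hk).2 g hg (by rintro rfl; exact hx hxk)

lemma exists_forall_mem_inter_zeroLocus_eq_empty [IsNoetherianRing A] (K : Ideal A) {e : ℕ}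
    (he : e ≠ 0) : ∀ (n : ℕ) (P : Fin n → Set A) (_ : ∀ i, ∀ C : Finset A, (∀ c ∈ C, c ∈ K) →
      ∃ y, ∀ c ∈ C, y + c ^ e ∈ P i) (Z : Set (PrimeSpectrum A)) (_ : IsClosed Z) (_ : DimLT Z n)
    (_ : Disjoint Z (PrimeSpectrum.zeroLocus K)),
    ∃ f : Fin n → A, (∀ i, f i ∈ P i) ∧ Disjoint Z (PrimeSpectrum.zeroLocus (Set.range f))
  | 0, P, _, Z, hZ, hdim, _ => ⟨Fin.elim0, fun i ↦ i.elim0, by simp [hdim.eq_empty hZ]⟩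
  | n + 1, P, hP, Z, hZ, hdim, hK => by
    obtain ⟨G, hGZ, hG, hGinc⟩ := exists_finset_generic hZ
    obtain ⟨C, hCK, hC⟩ := exists_finset_add_pow_notMem K G
      (fun g hg h ↦ Set.disjoint_left.mp hK (hGZ g hg) h)
      (fun g hg g' hg' h ↦ hGinc g hg g' hg' ((PrimeSpectrum.le_iff_specializes _ _).mp h)) he
    obtain ⟨y, hy⟩ := hP 0 C hCK
    obtain ⟨c, hc, hcG⟩ := hC y
    obtain ⟨f, hf, hfZ⟩ := exists_forall_mem_inter_zeroLocus_eq_empty K he n (fun i ↦ P i.succ)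
      (fun i ↦ hP i.succ) (Z ∩ PrimeSpectrum.zeroLocus {y + c ^ e})
      (hZ.inter (PrimeSpectrum.isClosed_zeroLocus _))
      (hdim.of_disjoint_generic hZ Set.inter_subset_left (G := G) hGZ hG
        (Set.disjoint_left.mpr fun g hg hg' ↦ hcG g hg (by simpa using hg'.2)))
      (hK.mono_left Set.inter_subset_left)
    refine ⟨Fin.cons (y + c ^ e) f, Fin.cases (hy c hc) hf, ?_⟩
    rw [Fin.range_cons, Set.insert_eq, PrimeSpectrum.zeroLocus_union]
    rw [Set.disjoint_left] at hfZ ⊢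
    exact fun x hx hx' ↦ hfZ ⟨hx, hx'.1⟩ hx'.2

end PrimeAvoidance

section SpanningFamilies

lemma exists_fin_span_eq_top {k V : Type*} [Field k] [AddCommGroup V] [Module k V]
    [Module.Finite k V] {r : ℕ} (hr : Module.finrank k V ≤ r) (S : Set V) (h0 : (0 : V) ∈ S)
    (hS : Submodule.span k S = ⊤) :
    ∃ v : Fin r → V, (∀ i, v i ∈ S) ∧ Submodule.span k (Set.range v) = ⊤ := by
  classical
  obtain ⟨b, hbS, hb, hli⟩ := exists_linearIndependent k S
  have : Finite b := hli.finite
  have := Fintype.ofFinite b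
  have hcard : Fintype.card b ≤ r := hli.fintype_card_le_finrank.trans hr
  obtain ⟨φ⟩ : Nonempty (b ↪ Fin r) := Function.Embedding.nonempty_of_card_le (by simpa using hcard)
  refine ⟨fun i ↦ if h : ∃ x, φ x = i then h.choose else 0, fun i ↦ ?_, top_unique ?_⟩
  · dsimp only
    split_ifs with h
    · exact hbS h.choose.2
    · exact h0
  · rw [← hS, ← hb]
    refine Submodule.span_mono fun x hx ↦ ⟨φ ⟨x, hx⟩, ?_⟩
    have h : ∃ y, φ y = φ ⟨x, hx⟩ := ⟨_, rfl⟩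
    simp only [h, ↓reduceDIte]
    exact congrArg Subtype.val (φ.injective h.choose_spec)

lemma exists_fin_span_sup_smul_eq_top {A M : Type*} [CommRing A] [AddCommGroup M] [Module A M]
    [Module.Finite A M] [Module.Flat A M] {r : ℕ} (q : Ideal A) [hq : q.IsMaximal]
    (hr : Module.rankAtStalk M ⟨q, hq.isPrime⟩ ≤ r) (S : Set M) (h0 : (0 : M) ∈ S)
    (hS : Submodule.span A S = ⊤) :
    ∃ v : Fin r → M, (∀ i, v i ∈ S) ∧ Submodule.span A (Set.range v) ⊔ q • ⊤ = ⊤ := by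
  let _ : Field (A ⧸ q) := Ideal.Quotient.field q
  have hrank : Module.finrank (A ⧸ q) (M ⧸ (q • ⊤ : Submodule A M)) ≤ r := by
    let e : TensorProduct A (A ⧸ q) M ≃ₗ[A ⧸ q] M ⧸ (q • ⊤ : Submodule A M) :=
      (TensorProduct.quotTensorEquivQuotSMul M q).extendScalarsOfSurjective
        Ideal.Quotient.mk_surjective
    rw [← e.finrank_eq]
    have := Module.rankAtStalk_baseChange (R := A) (M := M) (S := A ⧸ q) (⊥ : PrimeSpectrum (A ⧸ q))
    rw [Module.rankAtStalk_eq_finrank_of_free] at this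
    have h2 : PrimeSpectrum.comap (algebraMap A (A ⧸ q)) ⊥ = ⟨q, hq.isPrime⟩ := by
      ext x
      simp [Ideal.Quotient.eq_zero_iff_mem, PrimeSpectrum.asIdeal_bot]
    rw [h2] at this
    exact (this.trans_le hr)
  let π := (q • ⊤ : Submodule A M).mkQ
  obtain ⟨v, hv, hspan⟩ := exists_fin_span_eq_top hrank (π '' S) ⟨0, h0, map_zero _⟩ (by
    rw [← Submodule.restrictScalars_eq_top_iff A,
      Submodule.restrictScalars_span A (A ⧸ q) Ideal.Quotient.mk_surjective,
      Submodule.span_image, hS, Submodule.map_top, Submodule.range_mkQ])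
  choose w hwS hw using hv
  refine ⟨w, hwS, ?_⟩
  have h1 : Submodule.map π (Submodule.span A (Set.range w)) = ⊤ := by
    rw [← Submodule.restrictScalars_eq_top_iff A,
      Submodule.restrictScalars_span A (A ⧸ q) Ideal.Quotient.mk_surjective] at hspan
    rw [Submodule.map_span, ← Set.range_comp, ← hspan]
    congr 2
    exact funext hw
  have h2 := congrArg (Submodule.comap π) h1
  rwa [Submodule.comap_map_eq, Submodule.ker_mkQ, Submodule.comap_top] at h2

end SpanningFamilies

section Differentials

open KaehlerDifferential

variable {R A : Type*} [CommRing R] [CommRing A] [Algebra R A]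

lemma D_pow_mem_smul_top {I : Ideal A} {e : ℕ} (he : (e : A) ∈ I) (u : A) :
    D R A (u ^ e) ∈ (I • ⊤ : Submodule A (Ω[A⁄R])) := by
  rw [Derivation.leibniz_pow, ← Nat.cast_smul_eq_nsmul A]
  exact Submodule.smul_mem_smul he trivial

lemma D_sum_sub_D_mem_smul_top {I : Ideal A} {e : ℕ} (he0 : e ≠ 0) (he : (e : A) ∈ I)
    {ι : Type*} {s : Finset ι} (u y : ι → A) {j : ι} (hj : j ∈ s) (huj : u j - 1 ∈ I)
    (hu : ∀ p ∈ s, p ≠ j → u p ∈ I) :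
    D R A (∑ p ∈ s, u p ^ e * y p) - D R A (y j) ∈ (I • ⊤ : Submodule A (Ω[A⁄R])) := by
  classical
  have hpow := fun p ↦ D_pow_mem_smul_top (R := R) he (u p)
  rw [map_sum, ← Finset.add_sum_erase _ _ hj, add_sub_right_comm]
  refine add_mem ?_ (sum_mem fun p hp ↦ ?_)
  · have h1 : D R A (u j ^ e * y j) - D R A (y j) =
        (u j ^ e - 1) • D R A (y j) + y j • D R A (u j ^ e) := by
      rw [Derivation.leibniz, sub_smul, one_smul]
      abel
    rw [h1]
    refine add_mem (Submodule.smul_mem_smul ?_ trivial) (Submodule.smul_mem _ _ (hpow j))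
    rw [← Ideal.Quotient.eq_zero_iff_mem]
    have := Ideal.Quotient.eq.mpr huj
    simp [this]
  · obtain ⟨hpj, hp⟩ := Finset.mem_erase.mp hp
    rw [Derivation.leibniz]
    exact add_mem (Submodule.smul_mem_smul (Ideal.pow_mem_of_mem _ (hu p hp hpj) _
      (Nat.pos_of_ne_zero he0)) trivial) (Submodule.smul_mem _ _ (hpow p))

lemma span_range_le_span_range_sup {A M ι : Type*} [CommRing A] [AddCommGroup M] [Module A M]
    {v w : ι → M} {N : Submodule A M} (h : ∀ i, v i - w i ∈ N) :
    Submodule.span A (Set.range w) ≤ Submodule.span A (Set.range v) ⊔ N := by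
  refine Submodule.span_le.mpr ?_
  rintro _ ⟨i, rfl⟩
  have h1 := sub_mem (Submodule.mem_sup_left (T := N)
    (Submodule.subset_span (R := A) (Set.mem_range_self (f := v) i))) (Submodule.mem_sup_right (h i))
  rwa [sub_sub_cancel] at h1

lemma exists_D_span_sup_smul_eq_top [Module.Finite A (Ω[A⁄R])] [Module.Flat A (Ω[A⁄R])] {r : ℕ}
    (hr : ∀ q, Module.rankAtStalk (R := A) (Ω[A⁄R]) q ≤ r) (K : Ideal A)
    (hK : ∀ x : A, ∃ c : R, x - algebraMap R A c ∈ K) (Q : Finset (MaximalSpectrum A)) {e : ℕ} (he0 : e ≠ 0)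
    (he : ∀ q ∈ Q, (e : A) ∈ q.asIdeal) :
    ∃ t : Fin r → A, (∀ i, t i ∈ K) ∧ ∀ q ∈ Q,
      Submodule.span A (Set.range fun i ↦ D R A (t i)) ⊔ q.asIdeal • ⊤ = ⊤ := by
  classical
  have hspan : Submodule.span A (D R A '' K) = ⊤ := by
    rw [← span_range_derivation R A]
    refine le_antisymm (Submodule.span_mono (Set.image_subset_range _ _))
      (Submodule.span_mono ?_)
    rintro _ ⟨x, rfl⟩
    obtain ⟨c, hc⟩ := hK x
    exact ⟨_, hc, by simp⟩
  have key (q : MaximalSpectrum A) : ∃ y : Fin r → A, (∀ i, y i ∈ K) ∧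
      Submodule.span A (Set.range fun i ↦ D R A (y i)) ⊔ q.asIdeal • ⊤ = ⊤ := by
    have := q.isMaximal
    obtain ⟨v, hv, hvspan⟩ := exists_fin_span_sup_smul_eq_top q.asIdeal (hr _) (D R A '' K)
      ⟨0, K.zero_mem, map_zero _⟩ hspan
    choose y hyK hy using hv
    exact ⟨y, hyK, by simpa only [hy] using hvspan⟩
  choose y hyK hy using key
  have crt (q : MaximalSpectrum A) : ∃ u : A, ∀ q' ∈ Q,
      u - (if q' = q then 1 else 0) ∈ q'.asIdeal := by
    obtain ⟨u, hu⟩ := Ideal.exists_forall_sub_mem_ideal (I := fun q : Q ↦ q.1.asIdeal)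
      (fun p p' h ↦ Ideal.isCoprime_of_isMaximal fun h' ↦
        h (Subtype.ext (MaximalSpectrum.ext h')))
      (fun p ↦ if p.1 = q then 1 else 0)
    exact ⟨u, fun q' hq' ↦ hu ⟨q', hq'⟩⟩
  choose u hu using crt
  refine ⟨fun i ↦ ∑ q ∈ Q, u q ^ e * y q i,
    fun i ↦ sum_mem fun q _ ↦ K.mul_mem_left _ (hyK q i), fun q hq ↦ ?_⟩
  have hD (i : Fin r) : D R A (∑ p ∈ Q, u p ^ e * y p i) - D R A (y q i) ∈
      (q.asIdeal • ⊤ : Submodule A (Ω[A⁄R])) := by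
    refine D_sum_sub_D_mem_smul_top he0 (he q hq) u (fun p ↦ y p i) hq
      (by simpa using hu q q hq) (fun p _ hpq ↦ by simpa [hpq.symm] using hu p q hq)
  exact top_unique ((hy q).ge.trans (sup_le (span_range_le_span_range_sup hD) le_sup_right))

lemma sup_smul_top_eq_top_iff_disjoint_support {A M : Type*} [CommRing A] [AddCommGroup M]
    [Module A M] [Module.Finite A M] (N : Submodule A M) (I : Ideal A) :
    N ⊔ I • ⊤ = ⊤ ↔ Disjoint (Module.support A (M ⧸ N)) (PrimeSpectrum.zeroLocus I) := by
  have h1 : N ⊔ I • ⊤ = Submodule.comap N.mkQ (I • ⊤) := by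
    rw [← Submodule.range_mkQ N, ← Submodule.map_top, ← Submodule.map_smul'',
      Submodule.comap_map_eq, Submodule.ker_mkQ, sup_comm]
  rw [Set.disjoint_iff_inter_eq_empty, ← Module.support_quotient, Module.support_eq_empty_iff,
    Submodule.Quotient.subsingleton_iff, h1]
  refine ⟨fun h ↦ ?_, fun h ↦ by rw [h, Submodule.comap_top]⟩
  rw [← Submodule.map_comap_eq_of_surjective N.mkQ_surjective (I • ⊤), h, Submodule.map_top,
    Submodule.range_mkQ]

lemma isMaximal_of_finite_quotient {I : Ideal A} [Finite (A ⧸ I)] {q : Ideal A} (hq : q.IsPrime)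
    (h : I ≤ q) : q.IsMaximal := by
  have : Finite (A ⧸ q) := Finite.of_surjective _ (Ideal.Quotient.factor_surjective h)
  exact Ideal.Quotient.maximal_of_isField q (Finite.isField_of_domain _)

lemma finite_zeroLocus_of_finite_quotient (I : Ideal A) [Finite (A ⧸ I)] :
    (PrimeSpectrum.zeroLocus (I : Set A)).Finite := by
  have h := range_comap_of_surjective _ (Ideal.Quotient.mk I) Ideal.Quotient.mk_surjective
  rw [Ideal.mk_ker] at h
  exact h ▸ Set.finite_range _

theorem exists_mem_D_span_sup_smul_eq_top [IsNoetherianRing A] [Module.Finite A (Ω[A⁄R])]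
    [Module.Flat A (Ω[A⁄R])] {r : ℕ} (hr : ∀ q, Module.rankAtStalk (R := A) (Ω[A⁄R]) q ≤ r)
    (J : Ideal R) [Finite (R ⧸ J)] (K : Ideal A)
    (hK : ∀ x : A, ∃ c : R, x - algebraMap R A c ∈ K) {e : ℕ} (he0 : e ≠ 0) (he : (e : R) ∈ J)
    (hdim : DimLT (PrimeSpectrum.zeroLocus (J.map (algebraMap R A) : Set A)) (r + 1))
    (P : Fin r → Set A) (hP : ∀ i, ∀ t ∈ K, ∀ C : Finset A, (∀ c ∈ C, c ∈ K) →
      ∃ w, D R A w ∈ (J.map (algebraMap R A) • ⊤ : Submodule A (Ω[A⁄R])) ∧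
        ∀ c ∈ C, t + w + c ^ e ∈ P i) :
    ∃ f : Fin r → A, (∀ i, f i ∈ P i) ∧ Submodule.span A (Set.range fun i ↦ D R A (f i)) ⊔
      (J.map (algebraMap R A) ⊔ Ideal.span (Set.range f)) • ⊤ = ⊤ := by
  classical
  set JA := J.map (algebraMap R A) with hJA
  have heA : (e : A) ∈ JA := by simpa using Ideal.mem_map_of_mem (algebraMap R A) he
  have hfin : Finite (A ⧸ K ⊔ JA) := by
    let φ : R ⧸ J →+* A ⧸ K ⊔ JA := Ideal.quotientMap _ (algebraMap R A)
      (Ideal.map_le_iff_le_comap.mp le_sup_right)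
    refine Finite.of_surjective φ fun x ↦ ?_
    obtain ⟨x, rfl⟩ := Ideal.Quotient.mk_surjective x
    obtain ⟨c, hc⟩ := hK x
    refine ⟨Ideal.Quotient.mk _ c, ?_⟩
    rw [Ideal.quotientMap_mk, eq_comm, Ideal.Quotient.eq]
    exact Ideal.mem_sup_left hc
  obtain ⟨G, hGZ, hG, -⟩ := exists_finset_generic (PrimeSpectrum.isClosed_zeroLocus (JA : Set A))
  have hmax (g : PrimeSpectrum A) : ∃ q : MaximalSpectrum A, g.asIdeal ≤ q.asIdeal := by
    obtain ⟨q, hq, h⟩ := Ideal.exists_le_maximal g.asIdeal g.isPrime.ne_top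
    exact ⟨⟨q, hq⟩, h⟩
  choose q hq using hmax
  let Q : Finset (MaximalSpectrum A) :=
    G.image q ∪ (finite_zeroLocus_of_finite_quotient (K ⊔ JA)).toFinset.image q
  have hQJ : ∀ p ∈ Q, JA ≤ p.asIdeal := by
    simp only [Q, Finset.mem_union, Finset.mem_image, Set.Finite.mem_toFinset]
    rintro p (⟨g, hg, rfl⟩ | ⟨g, hg, rfl⟩)
    · exact (hGZ g hg : JA ≤ _).trans (hq g)
    · exact le_sup_right.trans ((hg : K ⊔ JA ≤ _).trans (hq g))
  obtain ⟨t, htK, ht⟩ := exists_D_span_sup_smul_eq_top hr K hK Q he0 fun p hp ↦ hQJ p hp heA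
  set N := Submodule.span A (Set.range fun i ↦ D R A (t i))
  have hQN (p) (hp : p ∈ Q) : p.toPrimeSpectrum ∉ Module.support A (Ω[A⁄R] ⧸ N) := fun h ↦
    Set.disjoint_left.mp ((sup_smul_top_eq_top_iff_disjoint_support _ _).mp (ht p hp)) h
      (le_refl p.asIdeal)
  obtain ⟨f, hf, hfZ⟩ := exists_forall_mem_inter_zeroLocus_eq_empty K he0 r
    (fun i ↦ {x ∈ P i | D R A x - D R A (t i) ∈ (JA • ⊤ : Submodule A (Ω[A⁄R]))}) (by
      intro i C hC
      obtain ⟨w, hw, h⟩ := hP i (t i) (htK i) C hC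
      refine ⟨t i + w, fun c hc ↦ ⟨h c hc, ?_⟩⟩
      rw [map_add, map_add, add_assoc, add_sub_cancel_left]
      exact add_mem hw (D_pow_mem_smul_top heA c))
    (PrimeSpectrum.zeroLocus JA ∩ Module.support A (Ω[A⁄R] ⧸ N))
    ((PrimeSpectrum.isClosed_zeroLocus _).inter Module.isClosed_support)
    (hdim.of_disjoint_generic (PrimeSpectrum.isClosed_zeroLocus _) Set.inter_subset_left (G := G)
      hGZ hG (Set.disjoint_left.mpr fun g hg hg' ↦ hQN (q g)
        (Finset.mem_union_left _ (Finset.mem_image_of_mem q hg))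
        (Module.mem_support_mono (hq g) hg'.2)))
    (Set.disjoint_left.mpr fun g hg hgK ↦ hQN (q g)
      (Finset.mem_union_right _ (Finset.mem_image_of_mem q (by
        rw [Set.Finite.mem_toFinset]
        exact sup_le (show K ≤ g.asIdeal from hgK) hg.1)))
      (Module.mem_support_mono (hq g) hg.2))
  refine ⟨f, fun i ↦ (hf i).1, top_unique ?_⟩
  have h1 : N ⊔ (JA ⊔ Ideal.span (Set.range f)) • ⊤ = ⊤ := by
    rw [sup_smul_top_eq_top_iff_disjoint_support, PrimeSpectrum.zeroLocus_sup,
      PrimeSpectrum.zeroLocus_span]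
    rw [Set.disjoint_left] at hfZ ⊢
    exact fun x hx hx' ↦ hfZ ⟨hx'.1, hx⟩ hx'.2
  exact h1.ge.trans (sup_le (span_range_le_span_range_sup fun i ↦
    Submodule.smul_mono_left le_sup_left (hf i).2) le_sup_right)

end Differentials

section EtaleQuotient

open KaehlerDifferential TensorProduct

variable {R A : Type u} [CommRing R] [CommRing A] [Algebra R A]

lemma subsingleton_kaehlerDifferential_quotient [Module.Finite A (Ω[A⁄R])] {I : Ideal A}
    [Module.Finite R (A ⧸ I)] {J : Ideal R} (hJ : J ≤ Ideal.jacobson ⊥)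
    (h : Submodule.span A (D R A '' I) ⊔ (J.map (algebraMap R A) ⊔ I) • ⊤ = ⊤) :
    Subsingleton (Ω[A ⧸ I⁄R]) := by
  let φ : Ω[A⁄R] →ₗ[A] Ω[A ⧸ I⁄R] := KaehlerDifferential.map R R A (A ⧸ I)
  have hφ : Function.Surjective φ :=
    KaehlerDifferential.map_surjective_of_surjective R R A (A ⧸ I) Ideal.Quotient.mk_surjective
  have hfinB : Module.Finite (A ⧸ I) (Ω[A ⧸ I⁄R]) := by
    have : Module.Finite A (Ω[A ⧸ I⁄R]) := Module.Finite.of_surjective φ hφ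
    exact Module.Finite.of_restrictScalars_finite A _ _
  have hfin : Module.Finite R (Ω[A ⧸ I⁄R]) := Module.Finite.trans (A ⧸ I) _
  have hle : (⊤ : Submodule A (Ω[A⁄R])) ≤
      Submodule.comap φ (J.map (algebraMap R A) • (⊤ : Submodule A (Ω[A ⧸ I⁄R]))) := by
    rw [← h, sup_le_iff]
    constructor
    · rw [Submodule.span_le]
      rintro _ ⟨x, hx, rfl⟩
      have hx0 : algebraMap A (A ⧸ I) x = 0 := Ideal.Quotient.eq_zero_iff_mem.mpr hx
      rw [SetLike.mem_coe, Submodule.mem_comap, KaehlerDifferential.map_D, hx0, map_zero]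
      exact zero_mem _
    · rw [← Submodule.map_le_iff_le_comap, Submodule.map_smul'', Submodule.sup_smul]
      refine sup_le (Submodule.smul_mono le_rfl le_top) (Submodule.smul_le.mpr fun a ha y _ ↦ ?_)
      have ha0 : algebraMap A (A ⧸ I) a = 0 := Ideal.Quotient.eq_zero_iff_mem.mpr ha
      rw [← algebraMap_smul (A ⧸ I) a y, ha0, zero_smul]
      exact zero_mem _
  rw [← Submodule.subsingleton_iff R, ← subsingleton_iff_bot_eq_top, eq_comm]
  refine Submodule.eq_bot_of_le_smul_of_le_jacobson_bot J _ Module.Finite.fg_top ?_ hJ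
  intro x _
  obtain ⟨x, rfl⟩ := hφ x
  have hx := hle (Submodule.mem_top (x := x))
  rwa [Submodule.mem_comap, ← Submodule.restrictScalars_mem R,
    Ideal.smul_restrictScalars, Submodule.restrictScalars_top] at hx

lemma etale_quotient_of_subsingleton [Algebra.Smooth R A] {r : ℕ}
    (hr : ∀ q, Module.rankAtStalk (R := A) (Ω[A⁄R]) q = r) (f : Fin r → A)
    [Subsingleton (Ω[A ⧸ Ideal.span (Set.range f)⁄R])] :
    Algebra.Etale R (A ⧸ Ideal.span (Set.range f)) := by
  classical
  set I := Ideal.span (Set.range f) with hI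
  have hfp : Algebra.FinitePresentation R (A ⧸ I) :=
    Algebra.FinitePresentation.quotient ⟨Finset.univ.image f, by simp [hI]⟩
  let B := A ⧸ I
  have hsurj : Function.Surjective (algebraMap A B) := Ideal.Quotient.mk_surjective
  have hf (i : Fin r) : algebraMap A B (f i) = 0 :=
    Ideal.Quotient.eq_zero_iff_mem.mpr (Ideal.subset_span ⟨i, rfl⟩)
  have hker (x : A) (hx : x ∈ RingHom.ker (algebraMap A B)) : ∃ a : Fin r → A,
      ∑ i, a i * f i = x := by
    rw [Ideal.Quotient.algebraMap_eq, Ideal.mk_ker, hI] at hx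
    exact Ideal.mem_span_range_iff_exists_fun.mp hx
  let φ : (Fin r → B) →ₗ[B] B ⊗[A] Ω[A⁄R] :=
    Fintype.linearCombination B fun i ↦ 1 ⊗ₜ D R A (f i)
  have hφ (a : Fin r → A) : (1 : B) ⊗ₜ[A] D R A (∑ i, a i * f i) =
      φ fun i ↦ algebraMap A B (a i) := by
    rw [map_sum, TensorProduct.tmul_sum, Fintype.linearCombination_apply]
    refine Finset.sum_congr rfl fun i _ ↦ ?_
    rw [Derivation.leibniz, TensorProduct.tmul_add, ← TensorProduct.smul_tmul,
      ← TensorProduct.smul_tmul, ← Algebra.algebraMap_eq_smul_one, ← Algebra.algebraMap_eq_smul_one,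
      hf, TensorProduct.zero_tmul, add_zero, TensorProduct.smul_tmul', smul_eq_mul, mul_one]
  have hφsurj : Function.Surjective φ := by
    intro y
    have hy : y ∈ LinearMap.range (kerCotangentToTensor R A B) := by
      rw [range_kerCotangentToTensor R A B hsurj]
      exact Subsingleton.elim (α := Ω[B⁄R]) _ _
    obtain ⟨x, rfl⟩ := hy
    obtain ⟨⟨x, hx⟩, rfl⟩ := Ideal.toCotangent_surjective _ x
    obtain ⟨a, rfl⟩ := hker x hx
    exact ⟨_, (hφ a).symm⟩
  have hφinj : Function.Injective φ := by
    refine (Module.bijective_of_surjective_of_rankAtStalk_eq hφsurj fun m hm ↦ ?_).injective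
    have : Nontrivial B := ⟨0, 1, fun h ↦ hm.ne_top ((Ideal.eq_top_iff_one _).mpr
      (h ▸ m.zero_mem))⟩
    rw [Module.rankAtStalk_eq_finrank_of_free, Module.rankAtStalk_baseChange, hr]
    simp
  have hH1 : Subsingleton (Algebra.H1Cotangent R B) := by
    rw [← Algebra.FormallySmooth.kerCotangentToTensor_injective_iff (P := A) hsurj,
      injective_iff_map_eq_zero]
    intro x hx
    obtain ⟨⟨x, hxk⟩, rfl⟩ := Ideal.toCotangent_surjective _ x
    obtain ⟨a, rfl⟩ := hker x hxk
    rw [kerCotangentToTensor_toCotangent, hφ, map_eq_zero_iff φ hφinj] at hx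
    rw [Ideal.toCotangent_eq_zero, pow_two]
    change ∑ i, a i * f i ∈ _
    exact sum_mem fun i _ ↦ Ideal.mul_mem_mul (RingHom.mem_ker.mpr (congrFun hx i))
      (RingHom.mem_ker.mpr (hf i))
  have : Algebra.FormallyEtale R B := ⟨inferInstance, hH1⟩
  exact ⟨inferInstance, inferInstance⟩

theorem etale_quotient [Algebra.Smooth R A] {r : ℕ}
    (hr : ∀ q, Module.rankAtStalk (R := A) (Ω[A⁄R]) q = r) {J : Ideal R}
    (hJ : J ≤ Ideal.jacobson ⊥) (f : Fin r → A) [Module.Finite R (A ⧸ Ideal.span (Set.range f))]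
    (h : Submodule.span A (Set.range fun i ↦ D R A (f i)) ⊔
      (J.map (algebraMap R A) ⊔ Ideal.span (Set.range f)) • ⊤ = ⊤) :
    Algebra.Etale R (A ⧸ Ideal.span (Set.range f)) := by
  have := subsingleton_kaehlerDifferential_quotient hJ (I := Ideal.span (Set.range f))
    (top_unique (h.ge.trans (sup_le_sup_right (Submodule.span_mono ?_) _)))
  · exact etale_quotient_of_subsingleton hr f
  · rintro _ ⟨i, rfl⟩
    exact ⟨f i, Ideal.subset_span ⟨i, rfl⟩, rfl⟩

lemma rankAtStalk_kaehlerDifferential [Algebra.Smooth R A] {n : ℕ} (p : PrimeSpectrum A) (s : A)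
    (hs : s ∉ p.asIdeal)
    [Algebra.IsStandardSmoothOfRelativeDimension n R (Localization.Away s)] :
    Module.rankAtStalk (R := A) (Ω[A⁄R]) p = n := by
  obtain ⟨q, rfl⟩ : p ∈ Set.range (PrimeSpectrum.comap (algebraMap A (Localization.Away s))) := by
    rw [PrimeSpectrum.localization_away_comap_range (Localization.Away s) s]
    exact hs
  have : Nontrivial (Localization.Away s) := q.nontrivial
  have : Algebra.FormallyEtale A (Localization.Away s) :=
    Algebra.FormallyEtale.of_isLocalization (Submonoid.powers s)
  have : Algebra.IsStandardSmooth R (Localization.Away s) :=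
    Algebra.IsStandardSmoothOfRelativeDimension.isStandardSmooth n
  have h := Module.rankAtStalk_isBaseChange
    (KaehlerDifferential.isBaseChange_of_formallyEtale R A (Localization.Away s)) q
  rw [← h, Module.rankAtStalk_eq_finrank_of_free, Pi.natCast_apply, Nat.cast_id]
  exact Module.finrank_eq_of_rank_eq
    (Algebra.IsStandardSmoothOfRelativeDimension.rank_kaehlerDifferential n)

end EtaleQuotient

section Avoidance

variable {R H : Type u} [CommRing R] [CommRing H] [Algebra R H] (𝒜 : ℕ → Submodule R H)
  [GradedAlgebra 𝒜]

lemma exists_homogeneous_mem_notMem {x y : ProjectiveSpectrum 𝒜} (hxy : ¬ y ⤳ x) :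
    ∃ n, ∃ h ∈ 𝒜 n, h ∈ y.asHomogeneousIdeal ∧ h ∉ x.asHomogeneousIdeal := by
  rw [specializes_iff_mem_closure, ← ProjectiveSpectrum.le_iff_mem_closure,
    ← ProjectiveSpectrum.as_ideal_le_as_ideal] at hxy
  obtain ⟨h, hy, hx⟩ := SetLike.not_le_iff_exists.mp hxy
  classical
  by_contra! hcon
  refine hx ?_
  rw [← DirectSum.sum_support_decompose 𝒜 h]
  exact sum_mem fun i _ ↦ hcon i _ (SetLike.coe_mem _) (y.asHomogeneousIdeal.isHomogeneous i hy)

lemma exists_homogeneous_pos_notMem (x : ProjectiveSpectrum 𝒜) :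
    ∃ n, 0 < n ∧ ∃ h ∈ 𝒜 n, h ∉ x.asHomogeneousIdeal := by
  obtain ⟨h, hi, hx⟩ := SetLike.not_le_iff_exists.mp x.not_irrelevant_le
  classical
  by_contra! hcon
  refine hx ?_
  rw [← DirectSum.sum_support_decompose 𝒜 h]
  refine sum_mem fun i _ ↦ ?_
  obtain rfl | hpos := Nat.eq_zero_or_pos i
  · rw [show ((DirectSum.decompose 𝒜 h 0 : 𝒜 0) : H) = 0 from
      (HomogeneousIdeal.mem_irrelevant_iff 𝒜 h).mp hi]
    exact zero_mem _
  · exact hcon i hpos _ (SetLike.coe_mem _)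

lemma exists_homogeneous_forall_notMem {ι : Type*} [Finite ι] (x : ι → ProjectiveSpectrum 𝒜)
    (hx : ∀ i j, x i ⤳ x j → i = j) :
    ∃ n, 0 < n ∧ ∃ h ∈ 𝒜 n, ∀ i, h ∉ (x i).asHomogeneousIdeal := by
  classical
  have := Fintype.ofFinite ι
  have (i : ι) : ∃ n, 0 < n ∧ ∃ h ∈ 𝒜 n, h ∉ (x i).asHomogeneousIdeal ∧
      ∀ j, j ≠ i → h ∈ (x j).asHomogeneousIdeal := by
    have h1 (j : ι) : ∃ n, ∃ h ∈ 𝒜 n, (j ≠ i → h ∈ (x j).asHomogeneousIdeal) ∧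
        h ∉ (x i).asHomogeneousIdeal := by
      by_cases hji : j = i
      · obtain ⟨n, -, h, hh, hi⟩ := exists_homogeneous_pos_notMem 𝒜 (x i)
        exact ⟨n, h, hh, fun h ↦ absurd hji h, hi⟩
      · obtain ⟨n, h, hh, hj, hi⟩ := exists_homogeneous_mem_notMem 𝒜 fun h ↦ hji (hx j i h)
        exact ⟨n, h, hh, fun _ ↦ hj, hi⟩
    choose n h hh hj hi using h1
    obtain ⟨n₀, hn₀, h₀, hh₀, hi₀⟩ := exists_homogeneous_pos_notMem 𝒜 (x i)
    have hprime : (x i).asHomogeneousIdeal.toIdeal.IsPrime := (x i).isPrime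
    refine ⟨n₀ + ∑ j, n j, by omega, h₀ * ∏ j, h j,
      SetLike.mul_mem_graded hh₀ (SetLike.prod_mem_graded _ _ _ fun j _ ↦ hh j), ?_, ?_⟩
    · refine hprime.mul_notMem hi₀ ?_
      rw [hprime.prod_mem_iff]
      rintro ⟨j, -, hj'⟩
      exact hi j hj'
    · intro j hji
      exact Ideal.mul_mem_left _ _ (Ideal.prod_mem _ (Finset.mem_univ j) (hj j hji))
  choose n hn h hh hi hj using this
  have hpos : 0 < ∏ i, n i := Finset.prod_pos fun i _ ↦ hn i
  refine ⟨∏ i, n i, hpos, ∑ i, h i ^ (∏ j ∈ Finset.univ.erase i, n j),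
    sum_mem fun i _ ↦ ?_, fun i hmem ↦ ?_⟩
  · rw [← Finset.prod_erase_mul _ _ (Finset.mem_univ i), ← smul_eq_mul]
    exact SetLike.pow_mem_graded _ (hh i)
  · have hprime : (x i).asHomogeneousIdeal.toIdeal.IsPrime := (x i).isPrime
    rw [← Finset.add_sum_erase _ _ (Finset.mem_univ i)] at hmem
    refine hi i (hprime.mem_of_pow_mem _ ((Submodule.add_mem_iff_left _ ?_).mp hmem))
    refine sum_mem fun j hj' ↦ Ideal.pow_mem_of_mem _ (hj j i ?_) _ (Finset.prod_pos fun k _ ↦ hn k)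
    exact (Finset.ne_of_mem_erase hj').symm

lemma exists_homogeneous_inter_eq_empty {Y : Scheme.{u}} [NoetherianSpace Y] (c : Y ⟶ Proj 𝒜)
    (hc : Topology.IsEmbedding c) {r : ℕ} {Z : Set Y} (hZ : IsClosed Z) (hdim : DimLT Z r) :
    ∃ (β : Fin r → H) (b : Fin r → ℕ), (∀ i, 0 < b i ∧ β i ∈ 𝒜 (b i)) ∧
      ∀ z ∈ Z, ∃ i, c z ∈ Proj.basicOpen 𝒜 (β i) := by
  induction r generalizing Z with
  | zero =>
    refine ⟨Fin.elim0, Fin.elim0, fun i ↦ i.elim0, fun z hz ↦ ?_⟩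
    rw [hdim.eq_empty hZ] at hz
    exact hz.elim
  | succ r ih =>
    obtain ⟨G, hGZ, hG, hanti⟩ := exists_finset_generic hZ
    obtain ⟨b₀, hb₀, β₀, hβ₀, hG₀⟩ := exists_homogeneous_forall_notMem 𝒜 (fun g : G ↦ c g.1)
      fun g g' h ↦ Subtype.ext (hanti _ g.2 _ g'.2 (hc.isInducing.specializes_iff.mp h))
    have hcl : IsClosed ((c ⁻¹ᵁ Proj.basicOpen 𝒜 β₀ : Set Y)ᶜ) :=
      (c ⁻¹ᵁ Proj.basicOpen 𝒜 β₀).isOpen.isClosed_compl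
    obtain ⟨β, b, hβ, h⟩ := ih (Z := Z ∩ (c ⁻¹ᵁ Proj.basicOpen 𝒜 β₀ : Set Y)ᶜ) (hZ.inter hcl)
      (hdim.of_disjoint_generic hZ Set.inter_subset_left hGZ hG
        (Set.disjoint_left.mpr fun g hg hg' ↦ hg'.2 (hG₀ ⟨g, hg⟩)))
    refine ⟨Fin.cons β₀ β, Fin.cons b₀ b, Fin.cases ⟨hb₀, hβ₀⟩ hβ, fun z hz ↦ ?_⟩
    by_cases hz₀ : c z ∈ Proj.basicOpen 𝒜 β₀
    · exact ⟨0, hz₀⟩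
    · obtain ⟨i, hi⟩ := h z ⟨hz, hz₀⟩
      exact ⟨i.succ, hi⟩

end Avoidance

section Dehomogenization

open HomogeneousLocalization

variable {R H A : Type u} [CommRing R] [CommRing H] [Algebra R H] {𝒜 : ℕ → Submodule R H}
  [GradedAlgebra 𝒜] [CommRing A] {x₀ : H} (ψ : Away 𝒜 x₀ →+* A)

/-- `a` is the image of `h / x₀ ^ n`, where `h` is homogeneous of degree `n`. -/
def IsDehomogenization (n : ℕ) (h : H) (a : A) : Prop :=
  h ∈ 𝒜 n ∧ ∃ z : Away 𝒜 x₀, ψ z = a ∧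
    z.val * algebraMap H (Localization.Away x₀) x₀ ^ n = algebraMap H _ h

variable {ψ} {n m : ℕ} {h h' : H} {a a' : A}

namespace IsDehomogenization

lemma add (H₁ : IsDehomogenization ψ n h a) (H₂ : IsDehomogenization ψ n h' a') :
    IsDehomogenization ψ n (h + h') (a + a') := by
  obtain ⟨hh, z, rfl, hz⟩ := H₁
  obtain ⟨hh', z', rfl, hz'⟩ := H₂
  exact ⟨add_mem hh hh', z + z', map_add .., by rw [val_add, add_mul, hz, hz', map_add]⟩

lemma neg (H₁ : IsDehomogenization ψ n h a) : IsDehomogenization ψ n (-h) (-a) := by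
  obtain ⟨hh, z, rfl, hz⟩ := H₁
  exact ⟨neg_mem hh, -z, map_neg .., by rw [val_neg, neg_mul, hz, map_neg]⟩

lemma mul (H₁ : IsDehomogenization ψ n h a) (H₂ : IsDehomogenization ψ m h' a') :
    IsDehomogenization ψ (n + m) (h * h') (a * a') := by
  obtain ⟨hh, z, rfl, hz⟩ := H₁
  obtain ⟨hh', z', rfl, hz'⟩ := H₂
  refine ⟨SetLike.mul_mem_graded hh hh', z * z', map_mul .., ?_⟩
  rw [val_mul, pow_add, mul_mul_mul_comm, hz, hz', map_mul]

lemma one : IsDehomogenization ψ 0 1 1 :=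
  ⟨SetLike.one_mem_graded 𝒜, 1, map_one ψ, by simp⟩

lemma pow (H₁ : IsDehomogenization ψ n h a) (k : ℕ) :
    IsDehomogenization ψ (k * n) (h ^ k) (a ^ k) := by
  induction k with
  | zero => simpa using one
  | succ k ih => simpa only [pow_succ, Nat.succ_mul] using ih.mul H₁

lemma mul_pow_self (hx₀ : x₀ ∈ 𝒜 1) (H₁ : IsDehomogenization ψ n h a) (k : ℕ) :
    IsDehomogenization ψ (n + k) (h * x₀ ^ k) a := by
  have h₁ : IsDehomogenization ψ 1 x₀ 1 := ⟨hx₀, 1, map_one ψ, by simp⟩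
  simpa using H₁.mul (h₁.pow k)

lemma of_le (hx₀ : x₀ ∈ 𝒜 1) (H₁ : IsDehomogenization ψ n h a) (hnm : n ≤ m) :
    IsDehomogenization ψ m (h * x₀ ^ (m - n)) a := by
  simpa [Nat.add_sub_cancel' hnm] using H₁.mul_pow_self hx₀ (m - n)

lemma algebraMap_zero [Algebra R A]
    (hψ : ∀ r, ψ (fromZeroRingHom 𝒜 _ (algebraMap R (𝒜 0) r)) = algebraMap R A r) (r : R) :
    IsDehomogenization ψ 0 (algebraMap R H r) (algebraMap R A r) := by
  refine ⟨(algebraMap R (𝒜 0) r).2, _, hψ r, ?_⟩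
  rw [pow_zero, mul_one]
  exact Localization.mk_one_eq_algebraMap _

lemma exists_of_mem (hx₀ : x₀ ∈ 𝒜 1) (hh : h ∈ 𝒜 n) : ∃ a, IsDehomogenization ψ n h a := by
  refine ⟨_, hh, Away.mk 𝒜 hx₀ n h (by simpa using hh), rfl, ?_⟩
  rw [Away.val_mk, ← map_pow, Localization.mk_eq_mk']
  exact IsLocalization.mk'_spec (M := Submonoid.powers x₀) _ h ⟨x₀ ^ n, n, rfl⟩

lemma exists_of_surjective (hx₀ : x₀ ∈ 𝒜 1) (hψ : Function.Surjective ψ) (a : A) :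
    ∃ n h, IsDehomogenization ψ n h a := by
  obtain ⟨z, rfl⟩ := hψ a
  obtain ⟨n, h, hh, rfl⟩ := Away.mk_surjective 𝒜 hx₀ z
  refine ⟨n, h, by simpa using hh, _, rfl, ?_⟩
  rw [Away.val_mk, ← map_pow, Localization.mk_eq_mk']
  exact IsLocalization.mk'_spec (M := Submonoid.powers x₀) _ h ⟨x₀ ^ n, n, rfl⟩

lemma mem_basicOpen_iff (hx₀ : x₀ ∈ 𝒜 1) (H₁ : IsDehomogenization ψ n h a) (hn : 0 < n)
    (q : Spec (CommRingCat.of A)) :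
    (Spec.map (CommRingCat.ofHom ψ) ≫ Proj.awayι 𝒜 x₀ hx₀ one_pos) q ∈ Proj.basicOpen 𝒜 h ↔
      a ∉ q.asIdeal := by
  obtain ⟨hh, z, rfl, hz⟩ := H₁
  have hz' : z = Away.isLocalizationElem hx₀ hh := by
    ext
    rw [Away.val_mk, pow_one, Localization.mk_eq_mk']
    refine (IsLocalization.eq_mk'_iff_mul_eq (M := Submonoid.powers x₀)).mpr ?_
    rw [← hz, map_pow]
  have := SetLike.ext_iff.mp (Proj.awayι_preimage_basicOpen 𝒜 hx₀ one_pos hh hn)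
    (Spec.map (CommRingCat.ofHom ψ) q)
  rw [Scheme.Hom.comp_apply]
  refine Iff.trans this ?_
  rw [hz']
  rfl

end IsDehomogenization

end Dehomogenization

section Admissible

open HomogeneousLocalization KaehlerDifferential

variable {R H A : Type u} [CommRing R] [CommRing H] [Algebra R H] {𝒜 : ℕ → Submodule R H}
  [GradedAlgebra 𝒜] [CommRing A] {x₀ : H} (ψ : Away 𝒜 x₀ →+* A)

/-- The elements of `K` which are dehomogenizations of forms of positive degree congruent to a
positive power of `β` modulo `x₀`. -/
def admissibleSet (K : Ideal A) (β : H) : Set A :=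
  {a | a ∈ K ∧ ∃ n k F, 0 < n ∧ 0 < k ∧ IsDehomogenization ψ n F a ∧ x₀ ∣ F - β ^ k}

variable {ψ}

lemma exists_add_add_pow_mem_admissibleSet [Algebra R A]
    (hψ : ∀ r, ψ (fromZeroRingHom 𝒜 _ (algebraMap R (𝒜 0) r)) = algebraMap R A r)
    (hsurj : Function.Surjective ψ) (hx₀ : x₀ ∈ 𝒜 1) {J : Ideal R} {K : Ideal A}
    (hK : ∀ x : A, ∃ c : R, x - algebraMap R A c ∈ K) {e : ℕ} (he0 : e ≠ 0) (he : (e : R) ∈ J)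
    {β : H} {b : ℕ} (hb : 0 < b) (hβ : β ∈ 𝒜 b) {t : A} (ht : t ∈ K) (C : Finset A)
    (hC : ∀ c ∈ C, c ∈ K) :
    ∃ w, D R A w ∈ (J.map (algebraMap R A) • ⊤ : Submodule A (Ω[A⁄R])) ∧
      ∀ c ∈ C, t + w + c ^ e ∈ admissibleSet ψ K β := by
  obtain ⟨n, h, ht'⟩ := IsDehomogenization.exists_of_surjective hx₀ hsurj t
  choose N G hG using IsDehomogenization.exists_of_surjective hx₀ hsurj
  let k := n + ∑ c ∈ C, N c + 1
  obtain ⟨y, hy⟩ := IsDehomogenization.exists_of_mem (ψ := ψ) hx₀ hβ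
  obtain ⟨ρ, hρ⟩ := hK ((y ^ k) ^ e)
  refine ⟨(y ^ k) ^ e - algebraMap R A ρ, ?_, fun c hc ↦ ⟨?_, ?_⟩⟩
  · rw [map_sub, Derivation.map_algebraMap, sub_zero]
    refine D_pow_mem_smul_top ?_ _
    simpa using Ideal.mem_map_of_mem (algebraMap R A) he
  · exact add_mem (add_mem ht hρ) (Ideal.pow_mem_of_mem _ (hC c hc) _ he0.bot_lt)
  · have he1 : 1 ≤ e := he0.bot_lt
    have hyd := (hy.pow k).pow e
    have hkb : k ≤ k * b := Nat.le_mul_of_pos_right _ hb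
    have hm : e * k ≤ e * (k * b) := Nat.mul_le_mul_left _ hkb
    have hN : N c ≤ ∑ c ∈ C, N c := Finset.single_le_sum (f := N) (fun _ _ ↦ Nat.zero_le _) hc
    have hck : N c < k := by omega
    have hn : n < e * (k * b) := (show n < k by omega).trans_le
      ((Nat.le_mul_of_pos_left k he1).trans hm)
    have hcn : e * N c < e * (k * b) := (Nat.mul_lt_mul_of_pos_left hck he1).trans_le hm
    rw [sub_eq_add_neg]
    have h0 : 0 < e * (k * b) := by omega
    refine ⟨e * (k * b), k * e, _, h0, by positivity, ((ht'.of_le hx₀ hn.le).add (hyd.add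
      ((IsDehomogenization.algebraMap_zero hψ ρ).of_le hx₀ h0.le).neg)).add
      (((hG c).pow e).of_le hx₀ hcn.le), ?_⟩
    have hd {i j : ℕ} (hij : i < j) (g : H) : x₀ ∣ g * x₀ ^ (j - i) :=
      Dvd.dvd.mul_left (dvd_pow_self _ (by omega)) _
    rw [pow_mul]
    have := (((hd hn h).sub (hd h0 (algebraMap R H ρ))).add (hd hcn (G c ^ e)))
    convert this using 1
    ring

end Admissible

section Chart

open HomogeneousLocalization

variable {R H : Type u} [CommRing R] [CommRing H] [Algebra R H] {𝒜 : ℕ → Submodule R H}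
  [GradedAlgebra 𝒜] {x₀ : H}

lemma awayToSection_awayι (hx₀ : x₀ ∈ 𝒜 1) :
    Spec.map (Proj.awayToSection 𝒜 x₀) ≫ Proj.awayι 𝒜 x₀ hx₀ one_pos =
      (Proj.isAffineOpen_basicOpen 𝒜 x₀ hx₀ one_pos).fromSpec := by
  have hU := Proj.isAffineOpen_basicOpen 𝒜 x₀ hx₀ one_pos
  rw [← cancel_epi hU.isoSpec.hom, hU.isoSpec_hom_fromSpec, hU.isoSpec_hom, ← Category.assoc]
  change Proj.basicOpenToSpec 𝒜 x₀ ≫ _ = _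
  rw [← Proj.basicOpenIsoSpec_hom 𝒜 x₀ hx₀ one_pos, Proj.awayι, Iso.hom_inv_id_assoc]

lemma exists_surjective_fromSpec_comp_eq (hx₀ : x₀ ∈ 𝒜 1) {Y : Scheme.{u}} (c : Y ⟶ Proj 𝒜)
    [IsClosedImmersion c] (hU : IsAffineOpen (c ⁻¹ᵁ Proj.basicOpen 𝒜 x₀)) :
    ∃ ψ : Away 𝒜 x₀ →+* Γ(Y, c ⁻¹ᵁ Proj.basicOpen 𝒜 x₀), Function.Surjective ψ ∧
      hU.fromSpec ≫ c = Spec.map (CommRingCat.ofHom ψ) ≫ Proj.awayι 𝒜 x₀ hx₀ one_pos := by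
  have hV := Proj.isAffineOpen_basicOpen 𝒜 x₀ hx₀ one_pos
  refine ⟨(Proj.awayToSection 𝒜 x₀ ≫ c.app _).hom, ?_, ?_⟩
  · rw [CommRingCat.hom_comp, RingHom.coe_comp]
    refine (c.app_surjective _ hV).comp ?_
    rw [← Proj.basicOpenIsoAway_hom 𝒜 x₀ hx₀ one_pos]
    exact (ConcreteCategory.bijective_of_isIso _).2
  · rw [CommRingCat.ofHom_hom, Spec.map_comp, Category.assoc, awayToSection_awayι hx₀,
      ← hV.SpecMap_appLE_fromSpec c hU le_rfl, Scheme.Hom.app_eq_appLE]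

end Chart

section Finite

open HomogeneousLocalization

variable {R H A : Type u} [CommRing R] [CommRing H] [Algebra R H] {𝒜 : ℕ → Submodule R H}
  [GradedAlgebra 𝒜] [CommRing A] {x₀ : H} {ψ : Away 𝒜 x₀ →+* A} [Algebra R A]

lemma range_specMap_mk {r : ℕ} (f : Fin r → A) :
    Set.range (Spec.map (CommRingCat.ofHom (Ideal.Quotient.mk (Ideal.span (Set.range f))))) =
      {q : Spec (CommRingCat.of A) | ∀ i, f i ∈ q.asIdeal} := by
  refine (range_comap_of_surjective _ _ Ideal.Quotient.mk_surjective).trans ?_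
  rw [Ideal.mk_ker, PrimeSpectrum.zeroLocus_span]
  ext q
  exact Set.range_subset_iff

lemma finite_quotient_of_mem_admissibleSet (hx₀ : x₀ ∈ 𝒜 1) {Y : Scheme.{u}} (c : Y ⟶ Proj 𝒜)
    (p : Y ⟶ Spec (CommRingCat.of R)) [IsProper p]
    (j : Spec (CommRingCat.of A) ⟶ Y) [IsOpenImmersion j]
    (hjc : j ≫ c = Spec.map (CommRingCat.ofHom ψ) ≫ Proj.awayι 𝒜 x₀ hx₀ one_pos)
    (hj : j.opensRange = c ⁻¹ᵁ Proj.basicOpen 𝒜 x₀)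
    (hjp : j ≫ p = Spec.map (CommRingCat.ofHom (algebraMap R A)))
    {r : ℕ} {β : Fin r → H} {f : Fin r → A} {K : Ideal A}
    (hf : ∀ i, f i ∈ admissibleSet ψ K (β i))
    (hβ : ∀ z : Y, z ∉ j.opensRange → (p z).asIdeal.IsMaximal →
      ∃ i, c z ∈ Proj.basicOpen 𝒜 (β i)) :
    Module.Finite R (A ⧸ Ideal.span (Set.range f)) := by
  choose hfK n k F hn hk hF hdvd using hf
  let W : Set Y := ⋂ i, ((c ⁻¹ᵁ Proj.basicOpen 𝒜 (F i) : Y.Opens) : Set Y)ᶜ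
  have hW : IsClosed W := isClosed_iInter fun i ↦ (c ⁻¹ᵁ Proj.basicOpen 𝒜 (F i)).isOpen.isClosed_compl
  have hWj : W ⊆ j.opensRange := by
    by_contra hnot
    obtain ⟨z, hzW, hzj⟩ := Set.not_subset.mp hnot
    have hcl : IsClosed (p '' (W ∩ (j.opensRange : Set Y)ᶜ)) :=
      p.isClosedMap _ (hW.inter j.opensRange.isOpen.isClosed_compl)
    obtain ⟨m, hm, hle⟩ := Ideal.exists_le_maximal _ (p z).isPrime.ne_top
    have hmem : (⟨m, hm.isPrime⟩ : PrimeSpectrum R) ∈ p '' (W ∩ (j.opensRange : Set Y)ᶜ) :=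
      ((PrimeSpectrum.le_iff_specializes (p z) ⟨m, hm.isPrime⟩).mp hle).mem_closed hcl
        ⟨z, ⟨hzW, hzj⟩, rfl⟩
    obtain ⟨y, ⟨hyW, hyj⟩, hy⟩ := hmem
    obtain ⟨i, hi⟩ := hβ y hyj (by rw [hy]; exact hm)
    have h1 : F i ∈ (c y).asHomogeneousIdeal := by
      have := Set.mem_iInter.mp hyW i
      exact not_not.mp this
    have h2 : x₀ ∈ (c y).asHomogeneousIdeal := by
      rw [hj] at hyj
      exact not_not.mp hyj
    have h3 : F i - β i ^ k i ∈ (c y).asHomogeneousIdeal.toIdeal := Ideal.mem_of_dvd _ (hdvd i) h2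
    have h4 : β i ^ k i ∈ (c y).asHomogeneousIdeal.toIdeal := by
      simpa using sub_mem (show F i ∈ (c y).asHomogeneousIdeal.toIdeal from h1) h3
    exact hi ((c y).isPrime.mem_of_pow_mem _ h4)
  let B := A ⧸ Ideal.span (Set.range f)
  let g : Spec (CommRingCat.of B) ⟶ Y :=
    Spec.map (CommRingCat.ofHom (Ideal.Quotient.mk (Ideal.span (Set.range f)))) ≫ j
  have hgW : Set.range g = W := by
    have hcoe : (g : Spec (CommRingCat.of B) → Y) = j ∘
        Spec.map (CommRingCat.ofHom (Ideal.Quotient.mk (Ideal.span (Set.range f)))) := by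
      ext q
      exact Scheme.Hom.comp_apply _ _ _
    rw [hcoe, Set.range_comp, range_specMap_mk]
    have key (q : Spec (CommRingCat.of A)) :
        (∀ i, f i ∈ q.asIdeal) ↔ j q ∈ W := by
      rw [Set.mem_iInter]
      refine forall_congr' fun i ↦ ?_
      have := (hF i).mem_basicOpen_iff hx₀ (hn i) q
      rw [← hjc] at this
      exact not_not.symm.trans (not_congr this.symm)
    ext z
    constructor
    · rintro ⟨q, hq, rfl⟩
      exact (key q).mp hq
    · intro hz
      obtain ⟨q, rfl⟩ := hWj hz
      exact ⟨q, (key q).mpr hz, rfl⟩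
  have : IsClosedImmersion (Spec.map (CommRingCat.ofHom
      (Ideal.Quotient.mk (Ideal.span (Set.range f))))) :=
    .spec_of_surjective _ Ideal.Quotient.mk_surjective
  have : IsPreimmersion g := inferInstanceAs (IsPreimmersion (_ ≫ j))
  have : IsClosedImmersion g := .of_isPreimmersion g (hgW ▸ hW)
  have hgp : g ≫ p = Spec.map (CommRingCat.ofHom (algebraMap R B)) := by
    rw [Category.assoc, hjp, ← Spec.map_comp, ← CommRingCat.ofHom_comp]
  have hfin : IsFinite (g ≫ p) := by
    rw [IsFinite.iff_isProper_and_isAffineHom]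
    exact ⟨inferInstance, by rw [hgp]; infer_instance⟩
  rw [hgp, IsFinite.SpecMap_iff] at hfin
  exact RingHom.finite_algebraMap.mp hfin

end Finite

section Main

open HomogeneousLocalization KaehlerDifferential

variable {R A : Type u} [CommRing R] [CommRing A] [Algebra R A]

lemma smooth_of_smoothOfRelativeDimension {r : ℕ}
    (h : SmoothOfRelativeDimension r (Spec.map (CommRingCat.ofHom (algebraMap R A)))) :
    Algebra.Smooth R A := by
  have := SmoothOfRelativeDimension.smooth r (Spec.map (CommRingCat.ofHom (algebraMap R A)))
  rw [HasRingHomProperty.Spec_iff (P := @Smooth)] at this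
  exact RingHom.smooth_algebraMap.mp this

lemma rankAtStalk_kaehlerDifferential_of_smoothOfRelativeDimension {r : ℕ}
    (h : SmoothOfRelativeDimension r (Spec.map (CommRingCat.ofHom (algebraMap R A))))
    (q : PrimeSpectrum A) : Module.rankAtStalk (R := A) (Ω[A⁄R]) q = r := by
  have := smooth_of_smoothOfRelativeDimension h
  rw [HasRingHomProperty.Spec_iff (P := @SmoothOfRelativeDimension r)] at h
  obtain ⟨s, hs, h⟩ := h
  obtain ⟨t, hts, htq⟩ : ∃ t ∈ s, t ∉ q.asIdeal := by
    by_contra! hcon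
    exact q.isPrime.ne_top (top_unique (hs ▸ Ideal.span_le.mpr hcon))
  have ht := h t hts
  rw [CommRingCat.hom_ofHom, ← IsScalarTower.algebraMap_eq R A (Localization.Away t),
    RingHom.isStandardSmoothOfRelativeDimension_algebraMap] at ht
  exact rankAtStalk_kaehlerDifferential q t htq

lemma finite_quotient_jacobson_bot [Finite (MaximalSpectrum R)]
    (hres : ∀ m : MaximalSpectrum R, Finite (R ⧸ m.asIdeal)) :
    Finite (R ⧸ (⊥ : Ideal R).jacobson) := by
  let φ : R →+* ∀ m : MaximalSpectrum R, R ⧸ m.asIdeal := RingHom.pi fun m ↦ Ideal.Quotient.mk _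
  have hφ : RingHom.ker φ = (⊥ : Ideal R).jacobson := by
    ext x
    rw [RingHom.mem_ker, Ideal.jacobson, Submodule.mem_sInf, funext_iff]
    constructor
    · rintro h m ⟨-, hm⟩
      exact Ideal.Quotient.eq_zero_iff_mem.mp (h ⟨m, hm⟩)
    · exact fun h m ↦ Ideal.Quotient.eq_zero_iff_mem.mpr (h _ ⟨bot_le, m.isMaximal⟩)
  rw [← hφ]
  exact Finite.of_injective _ (RingHom.kerLift_injective φ)

lemma natCast_card_quotient_mem (J : Ideal R) : ((Nat.card (R ⧸ J) : ℕ) : R) ∈ J := by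
  rw [← Ideal.Quotient.eq_zero_iff_mem, map_natCast, ← nsmul_one, card_nsmul_eq_zero']

theorem exists_finite_etale_quotient [IsNoetherianRing R] [Finite (MaximalSpectrum R)]
    (hres : ∀ m : MaximalSpectrum R, Finite (R ⧸ m.asIdeal)) {H : Type u} [CommRing H]
    [Algebra R H] {𝒜 : ℕ → Submodule R H} [GradedAlgebra 𝒜] {x₀ : H} (hx₀ : x₀ ∈ 𝒜 1)
    {ψ : Away 𝒜 x₀ →+* A} (hψ : Function.Surjective ψ)
    (hψR : ∀ r, ψ (fromZeroRingHom 𝒜 _ (algebraMap R (𝒜 0) r)) = algebraMap R A r)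
    {Y : Scheme.{u}} (c : Y ⟶ Proj 𝒜) (hc : Topology.IsEmbedding c)
    (p : Y ⟶ Spec (CommRingCat.of R)) [IsProper p]
    (j : Spec (CommRingCat.of A) ⟶ Y) [IsOpenImmersion j]
    (hjc : j ≫ c = Spec.map (CommRingCat.ofHom ψ) ≫ Proj.awayι 𝒜 x₀ hx₀ one_pos)
    (hj : j.opensRange = c ⁻¹ᵁ Proj.basicOpen 𝒜 x₀)
    (hjp : j ≫ p = Spec.map (CommRingCat.ofHom (algebraMap R A)))
    {r : ℕ} (hsm : SmoothOfRelativeDimension r (j ≫ p))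
    (hdim : ∀ s : MaximalSpectrum R,
      topologicalKrullDim (p ⁻¹' {s.toPrimeSpectrum} ∩ (c ⁻¹ᵁ Proj.basicOpen 𝒜 x₀ : Set Y) : Set Y) ≤ r)
    (hdim' : ∀ s : MaximalSpectrum R,
      topologicalKrullDim (p ⁻¹' {s.toPrimeSpectrum} ∩ (c ⁻¹ᵁ Proj.basicOpen 𝒜 x₀ : Set Y)ᶜ : Set Y) < r)
    (K : Ideal A) (hK : ∀ x : A, ∃ c : R, x - algebraMap R A c ∈ K) :
    ∃ f : Fin r → A, (∀ i, f i ∈ K) ∧ Module.Finite R (A ⧸ Ideal.span (Set.range f)) ∧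
      Algebra.Etale R (A ⧸ Ideal.span (Set.range f)) := by
  rw [hjp] at hsm
  have := smooth_of_smoothOfRelativeDimension hsm
  have hrank := rankAtStalk_kaehlerDifferential_of_smoothOfRelativeDimension hsm
  have : IsNoetherianRing A := Algebra.FiniteType.isNoetherianRing R A
  have := finite_quotient_jacobson_bot hres
  set J : Ideal R := Ideal.jacobson ⊥ with hJ
  have : IsLocallyNoetherian Y := LocallyOfFiniteType.isLocallyNoetherian p
  have : CompactSpace Y := QuasiCompact.compactSpace_of_compactSpace p
  have : IsNoetherian Y := {}
  have hclosed (s : MaximalSpectrum R) :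
      IsClosed (p ⁻¹' {s.toPrimeSpectrum}) :=
    IsClosed.preimage p.continuous
      ((PrimeSpectrum.isClosed_singleton_iff_isMaximal _).mpr s.isMaximal)
  -- forms without common zeros at infinity
  obtain ⟨β, b, hβ, hZ⟩ := exists_homogeneous_inter_eq_empty 𝒜 c hc
    (Z := ⋃ s : MaximalSpectrum R, p ⁻¹' {s.toPrimeSpectrum} ∩ (j.opensRange : Set Y)ᶜ) (r := r)
    (isClosed_iUnion_of_finite fun s ↦ (hclosed s).inter j.opensRange.isOpen.isClosed_compl)
    (DimLT.iUnion (fun s ↦ (hclosed s).inter j.opensRange.isOpen.isClosed_compl)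
      fun s ↦ dimLT_of_topologicalKrullDim_lt (hj ▸ hdim' s))
  -- the dimension of the closed fibres
  have hdimA : DimLT (PrimeSpectrum.zeroLocus (J.map (algebraMap R A) : Set A)) (r + 1) := by
    have hpj (q : Spec (CommRingCat.of A)) : p (j q) = PrimeSpectrum.comap (algebraMap R A) q := by
      rw [← Scheme.Hom.comp_apply, hjp]
      rfl
    refine DimLT.mono (DimLT.iUnion
      (Z := fun s : MaximalSpectrum R ↦ PrimeSpectrum.comap (algebraMap R A) ⁻¹'
        {s.toPrimeSpectrum}) (n := r + 1) (fun s ↦ ?_) fun s ↦ ?_) (fun q hq ↦ ?_) le_rfl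
    · exact IsClosed.preimage (PrimeSpectrum.continuous_comap _)
        ((PrimeSpectrum.isClosed_singleton_iff_isMaximal _).mpr s.isMaximal)
    · refine dimLT_of_topologicalKrullDim_lt (lt_of_le_of_lt ?_
        (WithBot.coe_lt_coe.mpr (Nat.cast_lt.mpr r.lt_succ_self)))
      refine le_trans ?_ (hj ▸ hdim s)
      have hmaps : Set.MapsTo j
          (PrimeSpectrum.comap (algebraMap R A) ⁻¹' {s.toPrimeSpectrum})
          (p ⁻¹' {s.toPrimeSpectrum} ∩ (j.opensRange : Set Y)) := fun q hq ↦
        ⟨(hpj q).trans hq, ⟨q, rfl⟩⟩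
      refine Topology.IsInducing.topologicalKrullDim_le (f := hmaps.restrict) ?_
      exact .of_comp (j.continuous.restrict hmaps) continuous_subtype_val
        (j.isOpenEmbedding.isInducing.comp .subtypeVal)
    · have hJq : J ≤ (PrimeSpectrum.comap (algebraMap R A) q).asIdeal :=
        Ideal.map_le_iff_le_comap.mp hq
      exact Set.mem_iUnion.mpr ⟨⟨_, isMaximal_of_finite_quotient
        (PrimeSpectrum.comap (algebraMap R A) q).isPrime hJq⟩, rfl⟩
  have he0 : Nat.card (R ⧸ J) ≠ 0 := Nat.card_pos.ne'
  have he := natCast_card_quotient_mem J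
  obtain ⟨f, hfP, hspan⟩ := exists_mem_D_span_sup_smul_eq_top (fun q ↦ (hrank q).le) J K hK he0 he
    hdimA (fun i ↦ admissibleSet ψ K (β i)) fun i t ht C hC ↦
      exists_add_add_pow_mem_admissibleSet hψR hψ hx₀ hK he0 he (hβ i).1 (hβ i).2 ht C hC
  have hfin : Module.Finite R (A ⧸ Ideal.span (Set.range f)) :=
    finite_quotient_of_mem_admissibleSet hx₀ c p j hjc hj hjp hfP fun z hz hmax ↦
      hZ z (Set.mem_iUnion.mpr ⟨⟨_, hmax⟩, rfl, hz⟩)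
  exact ⟨f, fun i ↦ (hfP i).1, hfin, etale_quotient hrank le_rfl f hspan⟩

end Main

lemma algebraMap_homogeneousSubmodule_zero_surjective (σ R : Type*) [CommRing R] :
    Function.Surjective (algebraMap R (MvPolynomial.homogeneousSubmodule σ R 0)) := by
  rintro ⟨x, hx⟩
  have hx' := MvPolynomial.totalDegree_eq_zero_iff_eq_C.mp
    (Nat.le_zero.mp (MvPolynomial.IsHomogeneous.totalDegree_le hx))
  exact ⟨x.coeff 0, Subtype.ext hx'.symm⟩

/-- The structure morphism `Proj 𝒜 ⟶ Spec R` of a graded `R`-algebra. -/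
abbrev projToSpec {R H : Type u} [CommRing R] [CommRing H] [Algebra R H] (𝒜 : ℕ → Submodule R H)
    [GradedAlgebra 𝒜] : Proj 𝒜 ⟶ Spec (CommRingCat.of R) :=
  Proj.toSpecZero 𝒜 ≫ Spec.map (CommRingCat.ofHom (algebraMap R (𝒜 0)))

lemma isProper_projToSpec {R H : Type u} [CommRing R] [CommRing H] [Algebra R H]
    (𝒜 : ℕ → Submodule R H) [GradedAlgebra 𝒜] [Algebra.FiniteType R H]
    (h : Function.Surjective (algebraMap R (𝒜 0))) : IsProper (projToSpec 𝒜) := by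
  have : IsScalarTower R (𝒜 0) H := ⟨fun a x y ↦ smul_mul_assoc a (x : H) y⟩
  have : Algebra.FiniteType (𝒜 0) H := .of_restrictScalars_finiteType R _ _
  have : IsClosedImmersion (Spec.map (CommRingCat.ofHom (algebraMap R (𝒜 0)))) :=
    IsClosedImmersion.spec_of_surjective _ h
  infer_instance

theorem exists_isClosedImmersion_finite_etale {R : Type u} [CommRing R] [IsNoetherianRing R]
    [Finite (MaximalSpectrum R)] (hres : ∀ m : MaximalSpectrum R, Finite (R ⧸ m.asIdeal))
    (I : Ideal R) {H : Type u} [CommRing H] [Algebra R H] {𝒜 : ℕ → Submodule R H}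
    [GradedAlgebra 𝒜] {x₀ : H} (hx₀ : x₀ ∈ 𝒜 1) {Xbar : Scheme.{u}} (c : Xbar ⟶ Proj 𝒜)
    [IsClosedImmersion c] [IsProper (projToSpec 𝒜)] {r : ℕ}
    (δ : Spec (CommRingCat.of (R ⧸ I)) ⟶ (c ⁻¹ᵁ Proj.basicOpen 𝒜 x₀).toScheme)
    (hδ : δ ≫ (c ⁻¹ᵁ Proj.basicOpen 𝒜 x₀).ι ≫ c ≫ projToSpec 𝒜 =
      Spec.map (CommRingCat.ofHom (Ideal.Quotient.mk I)))
    (hsm : SmoothOfRelativeDimension r ((c ⁻¹ᵁ Proj.basicOpen 𝒜 x₀).ι ≫ c ≫ projToSpec 𝒜))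
    (hdim : ∀ s : MaximalSpectrum R, topologicalKrullDim ((c ≫ projToSpec 𝒜) ⁻¹'
      {s.toPrimeSpectrum} ∩ (c ⁻¹ᵁ Proj.basicOpen 𝒜 x₀ : Set Xbar) : Set Xbar) ≤ r)
    (hdim' : ∀ s : MaximalSpectrum R, topologicalKrullDim ((c ≫ projToSpec 𝒜) ⁻¹'
      {s.toPrimeSpectrum} ∩ (c ⁻¹ᵁ Proj.basicOpen 𝒜 x₀ : Set Xbar)ᶜ : Set Xbar) < r) :
    ∃ (St : Scheme.{u}) (cl : St ⟶ (c ⁻¹ᵁ Proj.basicOpen 𝒜 x₀).toScheme),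
      IsClosedImmersion cl ∧
      IsFinite (cl ≫ (c ⁻¹ᵁ Proj.basicOpen 𝒜 x₀).ι ≫ c ≫ projToSpec 𝒜) ∧
      Etale (cl ≫ (c ⁻¹ᵁ Proj.basicOpen 𝒜 x₀).ι ≫ c ≫ projToSpec 𝒜) ∧
      Set.range δ ⊆ Set.range cl := by
  have hU : IsAffineOpen (c ⁻¹ᵁ Proj.basicOpen 𝒜 x₀) :=
    (Proj.isAffineOpen_basicOpen 𝒜 _ hx₀ one_pos).preimage c
  obtain ⟨ψ, hψ, hjc⟩ := exists_surjective_fromSpec_comp_eq (𝒜 := 𝒜) hx₀ c hU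
  let A : CommRingCat := Γ(Xbar, c ⁻¹ᵁ Proj.basicOpen 𝒜 x₀)
  let : Algebra R A := ((ψ.comp (HomogeneousLocalization.fromZeroRingHom 𝒜 _)).comp
    (algebraMap R (𝒜 0))).toAlgebra
  have hjp : hU.fromSpec ≫ c ≫ projToSpec 𝒜 =
      Spec.map (CommRingCat.ofHom (algebraMap R A)) := by
    rw [← Category.assoc, hjc, Category.assoc, Proj.awayι_toSpecZero_assoc,
      ← Spec.map_comp, ← Spec.map_comp]
    rfl
  have hX : hU.isoSpec.inv ≫ (c ⁻¹ᵁ Proj.basicOpen 𝒜 x₀).ι ≫ c ≫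
      projToSpec 𝒜 = Spec.map (CommRingCat.ofHom (algebraMap R A)) := hjp
  obtain ⟨φ, hφ⟩ := Spec.map_surjective (δ ≫ hU.isoSpec.hom)
  have hφR (a : R) : φ.hom (algebraMap R A a) = Ideal.Quotient.mk I a := by
    have : CommRingCat.ofHom (algebraMap R A) ≫ φ = CommRingCat.ofHom (Ideal.Quotient.mk I) := by
      apply Spec.map_injective
      rw [Spec.map_comp, hφ, ← hX, ← hδ, Category.assoc, Iso.hom_inv_id_assoc]
    exact congr($(this).hom a)
  have hsm' : SmoothOfRelativeDimension r (hU.fromSpec ≫ c ≫ projToSpec 𝒜) := by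
    have : SmoothOfRelativeDimension (0 + r) (hU.isoSpec.inv ≫
      (c ⁻¹ᵁ Proj.basicOpen 𝒜 x₀).ι ≫ c ≫ projToSpec 𝒜) := inferInstance
    rwa [zero_add] at this
  have hK (x : A) : ∃ a : R, x - algebraMap R A a ∈ RingHom.ker φ.hom := by
    obtain ⟨a, ha⟩ := Ideal.Quotient.mk_surjective (φ.hom x)
    exact ⟨a, by rw [RingHom.mem_ker, map_sub, hφR, ha, sub_self]⟩
  obtain ⟨f, hfK, hfin, het⟩ := exists_finite_etale_quotient hres hx₀ hψ (fun _ ↦ rfl) c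
    c.isClosedEmbedding.isEmbedding (c ≫ projToSpec 𝒜) hU.fromSpec hjc hU.opensRange_fromSpec hjp
    hsm' hdim hdim' (RingHom.ker φ.hom) hK
  refine ⟨_, Spec.map (CommRingCat.ofHom (Ideal.Quotient.mk (Ideal.span (Set.range f)))) ≫
    hU.isoSpec.inv, ?_, ?_, ?_, ?_⟩
  · have := IsClosedImmersion.spec_of_surjective
      (CommRingCat.ofHom (Ideal.Quotient.mk (Ideal.span (Set.range f))))
      Ideal.Quotient.mk_surjective
    infer_instance
  · rw [Category.assoc, hX, ← Spec.map_comp, IsFinite.SpecMap_iff]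
    exact RingHom.finite_algebraMap.mpr hfin
  · rw [Category.assoc, hX, ← Spec.map_comp, HasRingHomProperty.Spec_iff (P := @Etale)]
    exact RingHom.etale_algebraMap.mpr het
  · rintro _ ⟨y, rfl⟩
    have hy : Spec.map φ y ∈ Set.range (Spec.map (CommRingCat.ofHom
        (Ideal.Quotient.mk (Ideal.span (Set.range f))))) := by
      rw [range_specMap_mk]
      intro i
      change φ.hom (f i) ∈ y.asIdeal
      rw [RingHom.mem_ker.mp (hfK i)]
      exact zero_mem _
    obtain ⟨z, hz⟩ := hy
    refine ⟨z, ?_⟩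
    rw [Scheme.Hom.comp_apply, hz, hφ, ← Scheme.Hom.comp_apply, Category.assoc, Iso.hom_inv_id,
      Category.comp_id]

theorem exists_finite_etale_closed_subscheme_through_section
    (R : Type u) [CommRing R] [IsNoetherianRing R]
    -- `R` is semi-local …
    [Finite (MaximalSpectrum R)]
    -- … and regular …
    (hreg : ∀ (p : Ideal R) (hp : p.IsPrime),
      IsRegularLocalRing (Localization.AtPrime p (hp := hp)))
    -- … with finite residue fields at all closed points
    (hres : ∀ m : MaximalSpectrum R, Finite (R ⧸ m.asIdeal))
    -- `T = Spec (R ⧸ I)` is a closed subscheme of `S = Spec R`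
    (I : Ideal R)
    (d r : ℕ)
    -- `X̄` is a closed subscheme of `ℙ^d_S`
    (Xbar : Scheme.{u}) (c : Xbar ⟶ ProjSpace R d) (hc : IsClosedImmersion c) :
    -- `X = X̄ ∩ 𝔸^d_S`, the preimage in `X̄` of the affine chart `X₀ ≠ 0`
    ∀ (XO : Xbar.Opens),
      XO = c ⁻¹ᵁ Proj.basicOpen (MvPolynomial.homogeneousSubmodule (Fin (d + 1)) R)
        (MvPolynomial.X 0) →
    -- `δ : T → X` is a section over `T` of the projection `X → S`
    ∀ (δ : Spec (CommRingCat.of (R ⧸ I)) ⟶ XO.toScheme),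
      δ ≫ (XO.ι ≫ c ≫ ProjSpace.toSpec R d) =
        Spec.map (CommRingCat.ofHom (Ideal.Quotient.mk I)) →
    -- (1) `X` is smooth and equidimensional over `S` of relative dimension `r`
    IsSmoothOfRelativeDimension r (XO.ι ≫ c ≫ ProjSpace.toSpec R d) →
    -- (2) for every closed point `s ∈ S`, `dim X_∞(s) < dim X(s) = r`
    (∀ s : MaximalSpectrum R,
      topologicalKrullDim
        ((⇑(c ≫ ProjSpace.toSpec R d).base ⁻¹' {((s.toPrimeSpectrum : PrimeSpectrum R) :
            Spec (CommRingCat.of R))} ∩ (↑XO : Set Xbar)ᶜ : Set Xbar)) <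
        topologicalKrullDim
          ((⇑(c ≫ ProjSpace.toSpec R d).base ⁻¹' {((s.toPrimeSpectrum : PrimeSpectrum R) :
              Spec (CommRingCat.of R))} ∩ (↑XO : Set Xbar) : Set Xbar)) ∧
      topologicalKrullDim
        ((⇑(c ≫ ProjSpace.toSpec R d).base ⁻¹' {((s.toPrimeSpectrum : PrimeSpectrum R) :
            Spec (CommRingCat.of R))} ∩ (↑XO : Set Xbar) : Set Xbar)) = r) →
    -- conclusion: a closed subscheme `S̃ ⊆ X`, finite étale over `S`, containing `δ(T)`
    ∃ (St : Scheme.{u}) (cl : St ⟶ XO.toScheme),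
      IsClosedImmersion cl ∧
      IsFinite (cl ≫ XO.ι ≫ c ≫ ProjSpace.toSpec R d) ∧
      IsEtale (cl ≫ XO.ι ≫ c ≫ ProjSpace.toSpec R d) ∧
      Set.range ⇑δ.base ⊆ Set.range ⇑cl.base := by
  rintro XO rfl δ hδ hsm hdim
  have : IsClosedImmersion (Y := Proj (MvPolynomial.homogeneousSubmodule (Fin (d + 1)) R)) c := hc
  have := isProper_projToSpec (MvPolynomial.homogeneousSubmodule (Fin (d + 1)) R)
    (algebraMap_homogeneousSubmodule_zero_surjective _ R)
  exact exists_isClosedImmersion_finite_etale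
    (𝒜 := MvPolynomial.homogeneousSubmodule (Fin (d + 1)) R) hres I
    (MvPolynomial.isHomogeneous_X R 0) c δ hδ hsm (fun s ↦ (hdim s).2.le)
    fun s ↦ (hdim s).1.trans_eq (hdim s).2

end GS
end
end

section
/- Let k be a finite field and let A be a finitely generated smooth k-algebra such that Spec(A) is equidimensional of dimension one (a smooth affine curve over k). Let m be a maximal ideal of A. Then there exists a surjective k-algebra homomorphism k[t] → A/m²; equivalently, the finite k-scheme z^{(2)} := Spec(A/m²) admits a closed embedding into the affine line A¹_k. -/
/-!
STATEMENT 8: Let `k` be a finite field and `A` a finitely generated smooth `k`-algebra such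
that `Spec A` is equidimensional of dimension one (a smooth affine curve over `k`; here
equidimensionality of dimension one is expressed by saying that `A ⧸ p` has Krull dimension
one for every minimal prime `p` of `A`).  Let `m` be a maximal ideal of `A`.  Then there is a
surjective `k`-algebra homomorphism `k[t] → A/m²`, i.e. the first infinitesimal neighborhood
`z⁽²⁾ = Spec (A/m²)` admits a closed embedding into the affine line `𝔸¹_k`.
-/

universe u

open Polynomial in
/-- If `m / m ^ 2` is generated by one element, then the finite `k`-algebra `A / m ^ 2` is generated
by one element. -/
lemma Ideal.exists_surjective_polynomial_to_quotient_sq {k A : Type*} [Field k] [PerfectField k]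
    [CommRing A] [Algebra k A] [Algebra.FiniteType k A] (m : Ideal A) [m.IsMaximal]
    (a : A) (ham : a ∈ m) (ha : m ≤ Ideal.span {a} ⊔ m ^ 2) :
    ∃ φ : k[X] →ₐ[k] A ⧸ m ^ 2, Function.Surjective φ := by
  let _ : Field (A ⧸ m) := Ideal.Quotient.field m
  have : Module.Finite k (A ⧸ m) := finite_of_finite_type_of_isJacobsonRing k (A ⧸ m)
  obtain ⟨α', hα'⟩ := Field.exists_primitive_element k (A ⧸ m)
  obtain ⟨α, rfl⟩ := Ideal.Quotient.mk_surjective α'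
  have hint : IsIntegral k (Ideal.Quotient.mk m α) := .of_finite k _
  have hmk (p : k[X]) (x : A) : Ideal.Quotient.mk m (aeval x p) =
      aeval (Ideal.Quotient.mk m x) p :=
    (aeval_algHom_apply (Ideal.Quotient.mkₐ k m) x p).symm
  have hmk2 (p : k[X]) (x : A) :
      Ideal.Quotient.mk (m ^ 2) (aeval x p) =
      aeval (Ideal.Quotient.mk (m ^ 2) x) p :=
    (aeval_algHom_apply (Ideal.Quotient.mkₐ k (m ^ 2)) x p).symm
  have hsurj (x : A) : ∃ p : k[X], x - aeval α p ∈ m := by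
    have hx : Ideal.Quotient.mk m x ∈ Algebra.adjoin k {Ideal.Quotient.mk m α} := by
      rw [← IntermediateField.adjoin_simple_toSubalgebra_of_isAlgebraic hint.isAlgebraic, hα']
      trivial
    rw [Algebra.adjoin_singleton_eq_range_aeval] at hx
    obtain ⟨p, hp⟩ := hx
    refine ⟨p, ?_⟩
    rw [← Ideal.Quotient.eq, hmk]
    exact hp.symm
  set P := minpoly k (Ideal.Quotient.mk m α)
  have hP : aeval α P ∈ m := by
    rw [← Ideal.Quotient.eq_zero_iff_mem, hmk, minpoly.aeval]
  have hP' : Ideal.Quotient.mk m (aeval α (derivative P)) ≠ 0 := by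
    rw [hmk]
    exact (Algebra.IsSeparable.isSeparable k (Ideal.Quotient.mk m α)).aeval_derivative_ne_zero
      (minpoly.aeval _ _)
  obtain ⟨u, hu⟩ := Ideal.Quotient.mk_surjective
    (Ideal.Quotient.mk m (aeval α (derivative P)))⁻¹
  have hu : aeval α (derivative P) * u - 1 ∈ m := by
    rw [← Ideal.Quotient.eq, map_mul, hu, map_one, mul_inv_cancel₀ hP']
  have hε : u * (a - aeval α P) ∈ m := m.mul_mem_left _ (m.sub_mem ham hP)
  set β := α + u * (a - aeval α P)
  have hβ (p : k[X]) : aeval β p - aeval α p ∈ m := by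
    rw [← Ideal.Quotient.eq, hmk, hmk, map_add, Ideal.Quotient.eq_zero_iff_mem.mpr hε, add_zero]
  have hPβ : aeval β P - a ∈ m ^ 2 := by
    rw [← Ideal.Quotient.eq, hmk2, map_add, aeval_add_of_sq_eq_zero, ← hmk2, ← hmk2, ← map_mul,
      ← map_add, Ideal.Quotient.eq]
    · convert Ideal.mul_mem_mul hu (m.sub_mem ham hP) using 1
      · exact sq m
      · ring
    · rw [← map_pow, Ideal.Quotient.eq_zero_iff_mem]
      exact Ideal.pow_mem_pow hε 2
  refine ⟨aeval (Ideal.Quotient.mk (m ^ 2) β), fun y ↦ ?_⟩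
  obtain ⟨x, rfl⟩ := Ideal.Quotient.mk_surjective y
  have hsurj' (x : A) : ∃ p : k[X], x - aeval β p ∈ m := by
    obtain ⟨p, hp⟩ := hsurj x
    exact ⟨p, by simpa using m.sub_mem hp (hβ p)⟩
  obtain ⟨g, hg⟩ := hsurj' x
  obtain ⟨_, hy, z, hz, hyz⟩ := Submodule.mem_sup.mp (ha hg)
  obtain ⟨c, rfl⟩ := Ideal.mem_span_singleton'.mp hy
  obtain ⟨h, hh⟩ := hsurj' c
  refine ⟨g + h * P, ?_⟩
  rw [← hmk2, eq_comm, Ideal.Quotient.eq]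
  have h1 : (c - aeval β h) * a ∈ m ^ 2 := sq m ▸ Ideal.mul_mem_mul hh ham
  have h2 : aeval β h * (aeval β P - a) ∈ m ^ 2 := Ideal.mul_mem_left _ _ hPβ
  convert Ideal.sub_mem _ (Ideal.add_mem _ h1 hz) h2 using 1
  rw [map_add, map_mul]
  linear_combination -hyz

lemma Ideal.height_le_one_of_ringKrullDim_quotient_minimalPrimes_le_one {A : Type*} [CommRing A]
    (hdim : ∀ p ∈ minimalPrimes A, ringKrullDim (A ⧸ p) ≤ 1) (q : Ideal A) [q.IsPrime] :
    q.height ≤ 1 := by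
  rw [← Nat.cast_one, Ideal.height_le_iff]
  intro q' hq' hlt
  obtain ⟨p, hp, hpq⟩ := Ideal.exists_minimalPrimes_le (bot_le : ⊥ ≤ q')
  suffices q' ≤ p by
    obtain rfl := le_antisymm hpq this
    rw [Ideal.height_eq_zero_iff.mpr hp]
    simp
  by_contra hle
  have : p.IsPrime := hp.1.1
  have : Ring.KrullDimLE 1 (A ⧸ p) := (Order.krullDimLE_iff _ _).mpr (hdim p hp)
  have hmap : (q'.map (Ideal.Quotient.mk p)).IsPrime :=
    Ideal.map_isPrime_of_surjective Ideal.Quotient.mk_surjective (by simpa using hpq)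
  have hmax : (q'.map (Ideal.Quotient.mk p)).IsMaximal := by
    refine Ideal.isMaximal_of_isPrime_of_ne_bot _ ?_
    rwa [Ne, Ideal.map_eq_bot_iff_le_ker, Ideal.mk_ker]
  have hmax' : q'.IsMaximal := by
    have := Ideal.comap_isMaximal_of_surjective (Ideal.Quotient.mk p) Ideal.Quotient.mk_surjective
      (K := q'.map (Ideal.Quotient.mk p))
    rwa [Ideal.comap_map_of_surjective' _ Ideal.Quotient.mk_surjective, Ideal.mk_ker,
      sup_eq_left.mpr hpq] at this
  exact hlt.ne (hmax'.eq_of_le Ideal.IsPrime.ne_top' hlt.le)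

/-- If `m` becomes principal in the localization at `m`, then `m / m ^ 2` is generated by one
element. -/
lemma Ideal.exists_le_span_singleton_sup_sq_of_isPrincipal_map_localization {A L : Type*}
    [CommRing A] [CommRing L] [Algebra A L] (m : Ideal A) [m.IsMaximal] [IsLocalization.AtPrime L m]
    (h : (m.map (algebraMap A L)).IsPrincipal) :
    ∃ a ∈ m, m ≤ Ideal.span {a} ⊔ m ^ 2 := by
  obtain ⟨x, hx⟩ := h
  rw [← Ideal.span] at hx
  have hxm : x ∈ m.map (algebraMap A L) := hx ▸ Ideal.mem_span_singleton_self x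
  obtain ⟨⟨⟨a, ha⟩, s⟩, hs⟩ := (IsLocalization.mem_map_algebraMap_iff m.primeCompl L).mp hxm
  refine ⟨a, ha, fun b hb ↦ ?_⟩
  have hb' : algebraMap A L b ∈ (Ideal.span {a}).map (algebraMap A L) := by
    have hspan : Ideal.span {algebraMap A L a} = Ideal.span {x} := by
      rw [← hs]
      exact Ideal.span_singleton_mul_right_unit (IsLocalization.map_units L s) x
    rw [Ideal.map_span, Set.image_singleton, hspan, ← hx]
    exact Ideal.mem_map_of_mem _ hb
  obtain ⟨t, ht, htb⟩ :=
    (IsLocalization.algebraMap_mem_map_algebraMap_iff m.primeCompl L _ _).mp hb'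
  obtain ⟨y, z, hz, hyz⟩ := Ideal.IsMaximal.exists_inv ‹_› ht
  rw [← one_mul b, ← hyz, add_mul, mul_assoc]
  exact add_mem (Ideal.mem_sup_left (Ideal.mul_mem_left _ _ htb))
    (Ideal.mem_sup_right (sq m ▸ Ideal.mul_mem_mul hz hb))

/-- An étale algebra over a regular ring has principal maximal ideals in its local rings of
dimension at most one. -/
lemma Ideal.isPrincipal_map_localization_of_etale_of_height_le_one {R S : Type*}
    [CommRing R] [CommRing S] [Algebra R S] [IsRegularRing R] [IsNoetherianRing S]
    [Algebra.Etale R S] (M : Ideal S) [M.IsPrime] (hM : M.height ≤ 1) :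
    (M.map (algebraMap S (Localization.AtPrime M))).IsPrincipal := by
  let q := M.under R
  have hq : q.height ≤ 1 := by
    refine le_trans ?_ hM
    rw [Ideal.height_eq_height_add_of_liesOver_of_hasGoingDown q M]
    exact le_self_add
  let := Localization.AtPrime.algebraOfLiesOver q M
  have hmap := ((Algebra.isUnramifiedAt_iff_map_eq R q M).mp inferInstance).2
  have hprin : (IsLocalRing.maximalIdeal (Localization.AtPrime q)).IsPrincipal := by
    have hreg := (isRegularLocalRing_iff (Localization.AtPrime q)).mp inferInstance
    rw [IsLocalization.AtPrime.ringKrullDim_eq_height q] at hreg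
    have : (IsLocalRing.maximalIdeal (Localization.AtPrime q)).spanFinrank ≤ 1 := by
      have h : ((IsLocalRing.maximalIdeal (Localization.AtPrime q)).spanFinrank : ℕ∞) ≤ 1 := by
        rw [← WithBot.coe_le_coe]
        exact hreg.le.trans (WithBot.coe_le_coe.mpr hq)
      exact_mod_cast h
    rcases Nat.le_one_iff_eq_zero_or_eq_one.mp this with h | h
    · rw [Submodule.spanFinrank_eq_zero_iff_eq_bot (IsNoetherian.noetherian _)] at h
      rw [h]
      infer_instance
    · exact ((Submodule.spanFinrank_eq_one_iff _).mp h).1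
  rw [Localization.AtPrime.map_eq_maximalIdeal, ← hmap,
    IsScalarTower.algebraMap_eq R (Localization.AtPrime q), ← Ideal.map_map,
    Localization.AtPrime.map_eq_maximalIdeal]
  exact hprin.map_ringHom _

theorem exists_surjective_polynomial_to_square_of_maximalIdeal
    (k : Type u) [Field k] [Finite k]
    (A : Type u) [CommRing A] [Algebra k A] [Algebra.Smooth k A]
    (hdim : ∀ p ∈ minimalPrimes A, ringKrullDim (A ⧸ p) = 1)
    (m : Ideal A) (hm : m.IsMaximal) :
    ∃ φ : Polynomial k →ₐ[k] A ⧸ m ^ 2, Function.Surjective φ := by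
  have : IsNoetherianRing A := Algebra.FiniteType.isNoetherianRing k A
  obtain ⟨f, hf, n, _, _, _⟩ := Algebra.IsSmoothAt.exists_isStandardEtale_mvPolynomial
    (R := k) (p := m)
  let S := Localization.Away f
  have hdisj : Disjoint (Submonoid.powers f : Set A) m :=
    (Ideal.disjoint_powers_iff_notMem_of_isPrime _).mpr hf
  let M : Ideal S := m.map (algebraMap A S)
  have hMprime : M.IsPrime :=
    IsLocalization.isPrime_of_isPrime_disjoint (.powers f) _ _ hm.isPrime hdisj
  have hM : M.height ≤ 1 := by
    rw [IsLocalization.height_map_of_disjoint (.powers f) _ hdisj]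
    exact Ideal.height_le_one_of_ringKrullDim_quotient_minimalPrimes_le_one
      (fun p hp ↦ (hdim p hp).le) m
  have hcomap : M.comap (algebraMap A S) = m :=
    IsLocalization.under_map_of_isPrime_disjoint (.powers f) S hm.isPrime hdisj
  have hprin := Ideal.isPrincipal_map_localization_of_etale_of_height_le_one
    (R := MvPolynomial (Fin n) k) M hM
  have : IsLocalization.AtPrime (Localization.AtPrime M) m := by
    have := IsLocalization.isLocalization_isLocalization_atPrime_isLocalization
      (.powers f) (Localization.AtPrime M) M
    simpa only [hcomap] using this
  have hprin' : (m.map (algebraMap A (Localization.AtPrime M))).IsPrincipal := by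
    rwa [IsScalarTower.algebraMap_eq A S, ← Ideal.map_map]
  obtain ⟨a, ha, hma⟩ :=
    Ideal.exists_le_span_singleton_sup_sq_of_isPrincipal_map_localization m hprin'
  exact Ideal.exists_surjective_polynomial_to_quotient_sq m a ha hma
end
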